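/- Fix a prime number p and integers d, f ≥ 1, and let k be a field of characteristic zero. Consider 2f matrices of indeterminates X⁽⁰⁾,…,X⁽ᶠ⁻¹⁾ and Y⁽⁰⁾,…,Y⁽ᶠ⁻¹⁾, each of size d×d. Let A be the localization of the polynomial ring over k in these 2fd² variables at the element det(X⁽⁰⁾)·det(X⁽¹⁾)⋯det(X⁽ᶠ⁻¹⁾), and let I ⊆ A be the ideal generated by the f·d² entries of the matrices p·X⁽ⁱ⁾·Y⁽ⁱ⁻¹⁾ − Y⁽ⁱ⁾·X⁽ⁱ⁾ for i = 0,…,f−1 (superscripts taken modulo f). Then the ring A/I is reduced. -/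

import Mathlib

noncomputable section

variable (k : Type) [Field k] (p d f : ℕ)

/-- The polynomial ring over `k` in the `2·f·d²` entries of the matrices
`X⁽⁰⁾,…,X⁽ᶠ⁻¹⁾, Y⁽⁰⁾,…,Y⁽ᶠ⁻¹⁾`. -/
abbrev PKPoly := MvPolynomial (Fin 2 × Fin f × Fin d × Fin d) k

/-- The matrix of indeterminates `X⁽ⁱ⁾`. -/
def Xmat (i : Fin f) : Matrix (Fin d) (Fin d) (PKPoly k d f) :=
  Matrix.of fun a b => MvPolynomial.X (0, i, a, b)

/-- The matrix of indeterminates `Y⁽ⁱ⁾`. -/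
def Ymat (i : Fin f) : Matrix (Fin d) (Fin d) (PKPoly k d f) :=
  Matrix.of fun a b => MvPolynomial.X (1, i, a, b)

/-- The element `det(X⁽⁰⁾)·det(X⁽¹⁾)⋯det(X⁽ᶠ⁻¹⁾)`. -/
def detProd : PKPoly k d f := ∏ i : Fin f, (Xmat k d f i).det

/-- The localization `A` of the polynomial ring at `det(X⁽⁰⁾)⋯det(X⁽ᶠ⁻¹⁾)`. -/
abbrev PKLoc := Localization.Away (detProd k d f)

def XmatL (i : Fin f) : Matrix (Fin d) (Fin d) (PKLoc k d f) :=
  (Xmat k d f i).map (algebraMap (PKPoly k d f) (PKLoc k d f))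

def YmatL (i : Fin f) : Matrix (Fin d) (Fin d) (PKLoc k d f) :=
  (Ymat k d f i).map (algebraMap (PKPoly k d f) (PKLoc k d f))

/-- The ideal `I ⊆ A` generated by the `f·d²` entries of the matrices
`p·X⁽ⁱ⁾·Y⁽ⁱ⁻¹⁾ − Y⁽ⁱ⁾·X⁽ⁱ⁾`, `i = 0,…,f−1` (superscripts mod `f`). -/
def relIdeal [NeZero f] : Ideal (PKLoc k d f) :=
  Ideal.span {x | ∃ (i : Fin f) (a b : Fin d),
    x = ((p : PKLoc k d f) • (XmatL k d f i * YmatL k d f (i - 1)) -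
          YmatL k d f i * XmatL k d f i) a b}

section

open RingTheory.Sequence IsLocalRing Module

lemma exists_isRegular_quotSMulTop {R : Type} [CommRing R] [IsNoetherianRing R] [IsLocalRing R]
    {M : Type} [AddCommGroup M] [Module R M] [Module.Finite R M] {t : ℕ} {x : R}
    (hx : x ∈ maximalIdeal R) (reg : IsSMulRegular M x)
    (h : ∃ rs : List R, rs.length = t + 1 ∧ (∀ r ∈ rs, r ∈ maximalIdeal R) ∧ IsRegular M rs) :
    ∃ rs : List R, rs.length = t ∧ (∀ r ∈ rs, r ∈ maximalIdeal R) ∧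
      IsRegular (QuotSMulTop x M) rs := by
  obtain ⟨rs, hlen, hmem, hreg⟩ := h
  have hnt : Nontrivial M := hreg.nontrivial
  have smul_lt : maximalIdeal R • (⊤ : Submodule R M) < ⊤ :=
    (Submodule.top_ne_ideal_smul_of_le_jacobson_annihilator
      (IsLocalRing.maximalIdeal_le_jacobson _)).symm.lt_top
  have smul_lt' : maximalIdeal R • (⊤ : Submodule R (QuotSMulTop x M)) < ⊤ :=
    (have : Nontrivial (QuotSMulTop x M) := nontrivial_quotSMulTop_of_mem_maximalIdeal M hx
    Submodule.top_ne_ideal_smul_of_le_jacobson_annihilator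
      (IsLocalRing.maximalIdeal_le_jacobson _)).symm.lt_top
  have key := ((ModuleCat.exists_isRegular_tfae (maximalIdeal R) (t + 1) (ModuleCat.of R M)
    smul_lt).out 3 1 rfl rfl).mp ⟨rs, hlen, hmem, hreg⟩
  refine ((ModuleCat.exists_isRegular_tfae (maximalIdeal R) t
    (ModuleCat.of R (QuotSMulTop x M)) smul_lt').out 1 3 rfl rfl).mp fun i hi => ?_
  have zero1 := AddCommGrpCat.isZero_of_iff_subsingleton.mpr (key i (by omega))
  have zero2 := AddCommGrpCat.isZero_of_iff_subsingleton.mpr (key (i + 1) (by omega))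
  exact AddCommGrpCat.subsingleton_of_isZero <|
    CategoryTheory.ShortComplex.Exact.isZero_of_both_zeros
    ((CategoryTheory.Abelian.Ext.covariant_sequence_exact₃' _
      (IsSMulRegular.smulShortComplex_shortExact (M := ModuleCat.of R M) reg)) i (i + 1) rfl)
    (zero1.eq_zero_of_src _) (zero2.eq_zero_of_tgt _)

lemma ringKrullDim_quotient_add_one_le {R : Type} [CommRing R] {P Q : Ideal R} [P.IsPrime]
    (hPQ : P < Q) : ringKrullDim (R ⧸ Q) + 1 ≤ ringKrullDim (R ⧸ P) := by
  obtain ⟨hle, hnot⟩ := SetLike.lt_iff_le_and_exists.mp hPQ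
  obtain ⟨x, hxQ, hxP⟩ := hnot
  have hx : Ideal.Quotient.mk P x ∈ nonZeroDivisors (R ⧸ P) := by
    rw [mem_nonZeroDivisors_iff_ne_zero]
    rwa [Ne, Ideal.Quotient.eq_zero_iff_mem]
  refine le_trans ?_ (ringKrullDim_quotient_succ_le_of_nonZeroDivisor hx)
  gcongr
  let φ : (R ⧸ P) ⧸ Ideal.span {Ideal.Quotient.mk P x} →+* R ⧸ Q :=
    Ideal.Quotient.lift _ (Ideal.Quotient.factor hle) (by
      intro a ha
      obtain ⟨c, rfl⟩ := Ideal.mem_span_singleton.mp ha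
      rw [map_mul]
      simp [Ideal.Quotient.eq_zero_iff_mem.mpr hxQ])
  refine ringKrullDim_le_of_surjective φ (Ideal.Quotient.lift_surjective_of_surjective _ _ ?_)
  exact Ideal.Quotient.factor_surjective hle

lemma exists_isAssociatedPrime_quotSMulTop {R : Type} [CommRing R] [IsNoetherianRing R]
    [IsLocalRing R] {M : Type} [AddCommGroup M] [Module R M] [Module.Finite R M] {x : R}
    (hx : x ∈ maximalIdeal R) (reg : IsSMulRegular M x) {Q : Ideal R}
    (hQ : IsAssociatedPrime Q M) :
    ∃ Q', IsAssociatedPrime Q' (QuotSMulTop x M) ∧ Q < Q' := by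
  obtain ⟨hQp, m₀, hm₀⟩ := isAssociatedPrime_iff.mp hQ
  let N : Submodule R M := Submodule.torsionBySet R M Q
  have hm₀N : m₀ ∈ N := by
    rw [Submodule.mem_torsionBySet_iff]
    rintro ⟨a, ha⟩
    simpa [hm₀, Submodule.mem_colon] using ha
  have hm₀0 : m₀ ≠ 0 := by
    rintro rfl
    apply hQp.ne_top
    rw [hm₀, Ideal.eq_top_iff_one]
    simp [Submodule.mem_colon]
  have hN : N ≠ ⊥ := fun h => hm₀0 (by simpa [h] using hm₀N)
  have hlt : ¬ N ≤ maximalIdeal R • N := by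
    intro hle
    exact hN (Submodule.eq_bot_of_le_smul_of_le_jacobson_bot (maximalIdeal R) N
      (IsNoetherian.noetherian N) hle (IsLocalRing.maximalIdeal_le_jacobson _))
  obtain ⟨y, hyN, hy⟩ := Set.not_subset.mp hlt
  have hy0 : (Submodule.Quotient.mk y : QuotSMulTop x M) ≠ 0 := by
    intro h0
    rw [Submodule.Quotient.mk_eq_zero] at h0
    obtain ⟨z, -, rfl⟩ := (Submodule.mem_smul_pointwise_iff_exists _ _ _).mp h0
    apply hy
    refine Submodule.smul_mem_smul hx ?_
    rw [SetLike.mem_coe, Submodule.mem_torsionBySet_iff] at hyN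
    rw [Submodule.mem_torsionBySet_iff]
    intro a
    apply reg
    have := hyN a
    simp only [smul_zero]
    rw [smul_comm]
    exact this
  obtain ⟨Q', hQ', hle⟩ := exists_le_isAssociatedPrime_of_isNoetherianRing R
    (Submodule.Quotient.mk y : QuotSMulTop x M) hy0
  have hxQ : x ∉ Q := by
    intro hxQ
    rw [hm₀] at hxQ
    apply hm₀0
    apply reg
    simpa [Submodule.mem_colon] using hxQ
  refine ⟨Q', hQ', SetLike.lt_iff_le_and_exists.mpr ⟨fun a ha => hle ?_, x, hle ?_, hxQ⟩⟩
  · rw [SetLike.mem_coe, Submodule.mem_torsionBySet_iff] at hyN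
    have := hyN ⟨a, ha⟩
    simp only at this
    simp [Submodule.mem_colon, ← Submodule.Quotient.mk_smul, this]
  · simp only [Submodule.mem_colon_singleton, Submodule.mem_bot, ← Submodule.Quotient.mk_smul,
      Submodule.Quotient.mk_eq_zero]
    exact Submodule.smul_mem_pointwise_smul y x ⊤ trivial

lemma length_le_ringKrullDim_of_isAssociatedPrime {R : Type} [CommRing R] [IsNoetherianRing R]
    [IsLocalRing R] (rs : List R) (hrs : ∀ r ∈ rs, r ∈ maximalIdeal R) {M : Type} [AddCommGroup M]
    [Module R M] [Module.Finite R M] (hreg : IsRegular M rs) {Q : Ideal R}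
    (hQ : IsAssociatedPrime Q M) : (rs.length : WithBot ℕ∞) ≤ ringKrullDim (R ⧸ Q) := by
  induction rs generalizing M Q with
  | nil =>
    have := hQ.isPrime
    exact ringKrullDim_nonneg_of_nontrivial
  | cons x rs ih =>
    rw [isRegular_cons_iff] at hreg
    obtain ⟨Q', hQ', hlt⟩ := exists_isAssociatedPrime_quotSMulTop (hrs x (by simp)) hreg.1 hQ
    have := hQ.isPrime
    have h1 := ih (fun r hr => hrs r (by simp [hr])) hreg.2 hQ'
    have h2 := ringKrullDim_quotient_add_one_le hlt
    refine le_trans ?_ h2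
    simp only [List.length_cons, Nat.cast_add, Nat.cast_one]
    gcongr

lemma ringKrullDim_quotient_le_of_forall_isPrime {R : Type} [CommRing R] {J : Ideal R}
    {n : WithBot ℕ∞}
    (h : ∀ P : Ideal R, P.IsPrime → J ≤ P → ringKrullDim (R ⧸ P) ≤ n) :
    ringKrullDim (R ⧸ J) ≤ n := by
  rw [ringKrullDim_quotient, Order.krullDim]
  refine iSup_le fun p => ?_
  refine le_trans ?_ (h p.head.1.asIdeal p.head.1.2 p.head.2)
  rw [ringKrullDim_quotient]
  let q : LTSeries (PrimeSpectrum.zeroLocus (p.head.1.asIdeal : Set R)) :=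
    ⟨p.length, fun i => ⟨(p i).1, (p.head_le i : _)⟩, fun i => p.step i⟩
  exact Order.LTSeries.length_le_krullDim q

lemma ringKrullDim_quotient_le_add_length {R : Type} [CommRing R] [IsNoetherianRing R]
    [IsLocalRing R] {Q : Ideal R} [Q.IsPrime] {fs : List R} (hfs : ∀ r ∈ fs, r ∈ maximalIdeal R)
    {n : ℕ} (h : ∀ P : Ideal R, P.IsPrime → Q ≤ P → (∀ f ∈ fs, f ∈ P) →
      ringKrullDim (R ⧸ P) ≤ n) :
    ringKrullDim (R ⧸ Q) ≤ n + fs.length := by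
  classical
  have hloc : IsLocalRing (R ⧸ Q) :=
    IsLocalRing.of_surjective' (Ideal.Quotient.mk Q) Ideal.Quotient.mk_surjective
  let S : Finset (R ⧸ Q) := (fs.map (Ideal.Quotient.mk Q)).toFinset
  have hS : (S : Set (R ⧸ Q)) ⊆ maximalIdeal (R ⧸ Q) := by
    intro a ha
    simp only [S, List.coe_toFinset, List.mem_map, Set.mem_ofPred_eq] at ha
    obtain ⟨r, hr, rfl⟩ := ha
    rw [SetLike.mem_coe, mem_maximalIdeal, mem_nonunits_iff]
    intro hu
    obtain ⟨b, hb⟩ := hu.exists_right_inv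
    obtain ⟨c, rfl⟩ := Ideal.Quotient.mk_surjective b
    rw [← map_mul, ← map_one (Ideal.Quotient.mk Q), Ideal.Quotient.eq] at hb
    have h2 := IsLocalRing.le_maximalIdeal (Ideal.IsPrime.ne_top ‹Q.IsPrime›) hb
    have h3 := (Submodule.sub_mem_iff_right _
      (Ideal.mul_mem_right c _ (hfs r hr))).mp h2
    exact (Ideal.ne_top_iff_one _).mp (IsLocalRing.maximalIdeal.isMaximal R).ne_top h3
  have h1 := ringKrullDim_le_ringKrullDim_quotient_add_card S
    (by rwa [IsLocalRing.ringJacobson_eq_maximalIdeal])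
  refine h1.trans ?_
  gcongr
  · refine ringKrullDim_quotient_le_of_forall_isPrime fun P hP hSP => ?_
    have hP' := Ideal.comap_isPrime (Ideal.Quotient.mk Q) P
    have := h (P.comap (Ideal.Quotient.mk Q)) hP' ?_ ?_
    · refine le_trans ?_ this
      have hsurj : Function.Surjective ((Ideal.Quotient.mk P).comp (Ideal.Quotient.mk Q)) :=
        Ideal.Quotient.mk_surjective.comp Ideal.Quotient.mk_surjective
      refine ringKrullDim_le_of_surjective
        (Ideal.Quotient.lift (P.comap (Ideal.Quotient.mk Q))
          ((Ideal.Quotient.mk P).comp (Ideal.Quotient.mk Q)) ?_)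
        (Ideal.Quotient.lift_surjective_of_surjective _ _ hsurj)
      intro a ha
      rwa [RingHom.comp_apply, Ideal.Quotient.eq_zero_iff_mem, ← Ideal.mem_comap]
    · intro a ha
      rw [Ideal.mem_comap, Ideal.Quotient.eq_zero_iff_mem.mpr ha]
      exact P.zero_mem
    · intro f hf
      refine hSP (Ideal.subset_span ?_)
      simp only [S, List.coe_toFinset, List.mem_map, Set.mem_ofPred_eq]
      exact ⟨f, hf, rfl⟩
  · refine (List.toFinset_card_le _).trans ?_
    simp

theorem le_ringKrullDim_of_isAssociatedPrime_quotient {R : Type} [CommRing R] [IsNoetherianRing R]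
    [IsLocalRing R] (n : ℕ) (fs : List R) (hfs : ∀ r ∈ fs, r ∈ maximalIdeal R)
    {M : Type} [AddCommGroup M] [Module R M] [Module.Finite R M]
    (hM : ∃ rs : List R, rs.length = n + fs.length ∧ (∀ r ∈ rs, r ∈ maximalIdeal R) ∧
      IsRegular M rs)
    (hdim : ∀ P : Ideal R, P.IsPrime → Module.annihilator R M ≤ P → (∀ f ∈ fs, f ∈ P) →
      ringKrullDim (R ⧸ P) ≤ n)
    {Q : Ideal R} (hQ : IsAssociatedPrime Q (M ⧸ Ideal.ofList fs • (⊤ : Submodule R M))) :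
    (n : WithBot ℕ∞) ≤ ringKrullDim (R ⧸ Q) := by
  induction fs generalizing M with
  | nil =>
    obtain ⟨rs, hlen, hrs, hreg⟩ := hM
    have e : (M ⧸ Ideal.ofList ([] : List R) • (⊤ : Submodule R M)) ≃ₗ[R] M :=
      Submodule.quotEquivOfEqBot _ (by simp)
    rw [e.isAssociatedPrime_iff] at hQ
    have := length_le_ringKrullDim_of_isAssociatedPrime rs hrs hreg hQ
    simpa [hlen] using this
  | cons f fs ih =>
    have hf : f ∈ maximalIdeal R := hfs f (by simp)
    have hfs' : ∀ r ∈ fs, r ∈ maximalIdeal R := fun r hr => hfs r (by simp [hr])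
    have reg : IsSMulRegular M f := by
      by_contra hnot
      have : f ∈ ⋃ p ∈ associatedPrimes R M, (p : Set R) := by
        rw [biUnion_associatedPrimes_eq_compl_regular]
        exact hnot
      simp only [Set.mem_iUnion] at this
      obtain ⟨P, hP, hfP⟩ := this
      obtain ⟨rs, hlen, hrs, hreg⟩ := hM
      have h1 := length_le_ringKrullDim_of_isAssociatedPrime rs hrs hreg hP
      have := hP.isPrime
      have h2 := ringKrullDim_quotient_le_add_length (Q := P) hfs' (n := n) fun P' hP' hle hfs'' =>
        hdim P' hP' ((Submodule.annihilator_top (R := R) (M := M) ▸ hP.annihilator_le).trans hle)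
            (by
          intro g hg
          rcases List.mem_cons.mp hg with rfl | hg
          · exact hle hfP
          · exact hfs'' g hg)
      have h3 := h1.trans h2
      rw [hlen] at h3
      norm_cast at h3
      simp at h3
    refine ih hfs' (M := QuotSMulTop f M) ?_ ?_ ?_
    · exact exists_isRegular_quotSMulTop hf reg hM
    · intro P hP hann hfP
      refine hdim P hP ((LinearMap.annihilator_le_of_surjective
        (Submodule.mkQ _) (Submodule.mkQ_surjective _)).trans hann) ?_
      intro g hg
      rcases List.mem_cons.mp hg with rfl | hg
      · refine hann ?_
        rw [Module.mem_annihilator]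
        intro m
        obtain ⟨m, rfl⟩ := Submodule.Quotient.mk_surjective _ m
        rw [← Submodule.Quotient.mk_smul, Submodule.Quotient.mk_eq_zero]
        exact Submodule.smul_mem_pointwise_smul m g ⊤ trivial
      · exact hfP g hg
    · exact (Submodule.quotOfListConsSMulTopEquivQuotSMulTopInner M f fs).isAssociatedPrime_iff.mp
        hQ

end

section

open RingTheory.Sequence IsLocalRing Module

lemma exists_isWeaklyRegular_polynomial {k : Type} [Field k] {R : Type} [CommRing R] [Algebra k R]
    {n : ℕ} (h : ∀ M : Ideal R, Algebra.IsIntegral k (R ⧸ M) →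
      ∃ rs : List R, rs.length = n ∧ (∀ r ∈ rs, r ∈ M) ∧ IsWeaklyRegular R rs)
    (M : Ideal (Polynomial R)) (hM : Algebra.IsIntegral k (Polynomial R ⧸ M)) :
    ∃ rs : List (Polynomial R), rs.length = n + 1 ∧ (∀ r ∈ rs, r ∈ M) ∧
      IsWeaklyRegular (Polynomial R) rs := by
  let φ : R →ₐ[k] Polynomial R := Polynomial.CAlgHom
  have hintg : Algebra.IsIntegral k (R ⧸ M.comap φ) :=
    Algebra.IsIntegral.of_injective (Ideal.quotientMapₐ M φ le_rfl)
      (Ideal.quotientMap_injective (f := φ.toRingHom))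
  obtain ⟨rs, hlen, hrs, hreg⟩ := h (M.comap φ) hintg
  obtain ⟨p, hp, hpX⟩ := hM.isIntegral (Ideal.Quotient.mk M (Polynomial.X))
  have hpM : p.map (algebraMap k R) ∈ M := by
    rw [← Ideal.Quotient.eq_zero_iff_mem, ← hpX]
    rw [← Polynomial.aeval_def, ← Ideal.Quotient.mkₐ_eq_mk k, Polynomial.aeval_algHom_apply]
    rw [Polynomial.aeval_def, Polynomial.eval₂_eq_eval_map,
      IsScalarTower.algebraMap_eq k R (Polynomial R), ← Polynomial.map_map,
          Polynomial.algebraMap_eq,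
      ← Polynomial.eval₂_eq_eval_map, Polynomial.eval₂_C_X]
  have hmon : (p.map (algebraMap k R)).Monic := hp.map _
  refine ⟨rs.map (algebraMap R (Polynomial R)) ++ [p.map (algebraMap k R)], by simp [hlen], ?_, ?_⟩
  · intro r hr
    rcases List.mem_append.mp hr with hr | hr
    · obtain ⟨a, ha, rfl⟩ := List.mem_map.mp hr
      exact hrs a ha
    · rw [List.mem_singleton.mp hr]
      exact hpM
  · rw [isWeaklyRegular_append_iff]
    refine ⟨hreg.of_flat, ?_⟩
    rw [isWeaklyRegular_singleton_iff]
    rw [isSMulRegular_iff_right_eq_zero_of_smul]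
    intro x hx
    obtain ⟨g, rfl⟩ := Submodule.Quotient.mk_surjective _ x
    rw [← Submodule.Quotient.mk_smul, Submodule.Quotient.mk_eq_zero] at hx
    rw [Submodule.Quotient.mk_eq_zero]
    rw [← Ideal.map_ofList, smul_eq_mul, Ideal.mul_top, Polynomial.algebraMap_eq,
      ← Ideal.Quotient.eq_zero_iff_mem] at hx ⊢
    have key : ∀ u : Polynomial R, Ideal.Quotient.mk (Ideal.map Polynomial.C (Ideal.ofList rs)) u
        = 0
        ↔ u.map (Ideal.Quotient.mk (Ideal.ofList rs)) = 0 := by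
      intro u
      rw [Ideal.Quotient.eq_zero_iff_mem, Ideal.mem_map_C_iff, Polynomial.ext_iff]
      simp [Ideal.Quotient.eq_zero_iff_mem]
    rw [key] at hx ⊢
    rw [smul_eq_mul, Polynomial.map_mul] at hx
    exact (hmon.map _).mul_right_eq_zero_iff.mp hx

lemma exists_isWeaklyRegular_of_algEquiv {k : Type} [Field k] {R S : Type} [CommRing R]
    [Algebra k R] [CommRing S] [Algebra k S] (e : S ≃ₐ[k] R) {n : ℕ}
    (h : ∀ M : Ideal R, Algebra.IsIntegral k (R ⧸ M) →
      ∃ rs : List R, rs.length = n ∧ (∀ r ∈ rs, r ∈ M) ∧ IsWeaklyRegular R rs)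
    (M : Ideal S) (hM : Algebra.IsIntegral k (S ⧸ M)) :
    ∃ rs : List S, rs.length = n ∧ (∀ r ∈ rs, r ∈ M) ∧ IsWeaklyRegular S rs := by
  have hintg : Algebra.IsIntegral k (R ⧸ M.comap e.symm) :=
    Algebra.IsIntegral.of_injective (Ideal.quotientMapₐ M (e.symm : R →ₐ[k] S) le_rfl)
      (Ideal.quotientMap_injective (f := (e.symm : R →ₐ[k] S).toRingHom))
  obtain ⟨rs, hlen, hrs, hreg⟩ := h _ hintg
  refine ⟨rs.map e.symm, by simp [hlen], ?_, ?_⟩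
  · intro r hr
    obtain ⟨a, ha, rfl⟩ := List.mem_map.mp hr
    exact hrs a ha
  · refine (AddEquiv.isWeaklyRegular_congr (e := e.symm.toAddEquiv) ?_).mp hreg
    rw [List.forall₂_map_right_iff, List.forall₂_same]
    intro x _ y
    simp

theorem exists_isWeaklyRegular_mvPolynomial {k : Type} [Field k] (n : ℕ)
    (M : Ideal (MvPolynomial (Fin n) k)) (hM : Algebra.IsIntegral k (MvPolynomial (Fin n) k ⧸ M)) :
    ∃ rs : List (MvPolynomial (Fin n) k), rs.length = n ∧ (∀ r ∈ rs, r ∈ M) ∧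
      IsWeaklyRegular (MvPolynomial (Fin n) k) rs := by
  induction n with
  | zero => exact ⟨[], rfl, by simp, IsWeaklyRegular.nil _ _⟩
  | succ n ih =>
    exact exists_isWeaklyRegular_of_algEquiv (MvPolynomial.finSuccEquiv k n)
      (exists_isWeaklyRegular_polynomial ih) M hM

theorem exists_isRegular_localization_mvPolynomial {k : Type} [Field k] {σ : Type} [Finite σ]
    (M : Ideal (MvPolynomial σ k)) [hM : M.IsMaximal] :
    ∃ rs : List (Localization.AtPrime M), rs.length = Nat.card σ ∧
      (∀ r ∈ rs, r ∈ maximalIdeal (Localization.AtPrime M)) ∧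
      IsRegular (Localization.AtPrime M) rs := by
  let : Field (MvPolynomial σ k ⧸ M) := Ideal.Quotient.field M
  have hfin : Module.Finite k (MvPolynomial σ k ⧸ M) :=
    finite_of_finite_type_of_isJacobsonRing k (MvPolynomial σ k ⧸ M)
  obtain ⟨rs, hlen, hrs, hreg⟩ := exists_isWeaklyRegular_of_algEquiv
    (MvPolynomial.renameEquiv k (Finite.equivFin σ)) (exists_isWeaklyRegular_mvPolynomial _) M
    inferInstance
  refine ⟨rs.map (algebraMap _ (Localization.AtPrime M)), by simp [hlen], ?_,
    hreg.isRegular_of_isLocalization_of_mem _ M hrs⟩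
  intro r hr
  obtain ⟨a, ha, rfl⟩ := List.mem_map.mp hr
  rw [← Localization.AtPrime.map_eq_maximalIdeal]
  exact Ideal.mem_map_of_mem _ (hrs a ha)

lemma ringKrullDim_le_of_isIntegral {R S : Type} [CommRing R] [CommRing S] [Algebra R S]
    [Algebra.IsIntegral R S] : ringKrullDim S ≤ ringKrullDim R := by
  refine Order.krullDim_le_of_strictMono
    (fun p : PrimeSpectrum S => (PrimeSpectrum.comap (algebraMap R S) p)) ?_
  intro p q hpq
  obtain ⟨hle, x, hxq, hxp⟩ := SetLike.lt_iff_le_and_exists.mp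
    (show p.asIdeal < q.asIdeal from hpq)
  exact Ideal.comap_lt_comap_of_integral_mem_sdiff hle ⟨hxq, hxp⟩
    (Algebra.IsIntegral.isIntegral (R := R) x)

lemma ringKrullDim_localization_quotient_le {R S : Type} [CommRing R] [CommRing S] [Algebra R S]
    (T : Submonoid R) [IsLocalization T S] (Q : Ideal S) [Q.IsPrime] :
    ringKrullDim (S ⧸ Q) ≤ ringKrullDim (R ⧸ Q.comap (algebraMap R S)) := by
  rw [ringKrullDim_quotient, ringKrullDim_quotient]
  refine Order.krullDim_le_of_strictMono
    (fun p => ⟨PrimeSpectrum.comap (algebraMap R S) p.1, ?_⟩) ?_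
  · exact Ideal.comap_mono (f := algebraMap R S) p.2
  · intro p q hpq
    refine lt_of_le_of_ne (Ideal.comap_mono (f := algebraMap R S) hpq.le) ?_
    intro h
    have h' := PrimeSpectrum.localization_comap_injective S T (Subtype.ext_iff.mp h)
    exact hpq.ne (Subtype.ext h')

theorem ringKrullDim_le_of_trdeg_le {k : Type} [Field k] {A F : Type} [CommRing A] [IsDomain A]
    [Algebra k A] [Algebra.FiniteType k A] [Field F] [Algebra k F] [Algebra A F]
    [IsScalarTower k A F] [FaithfulSMul A F] {n : ℕ}
    (h : Algebra.trdeg k F ≤ n) : ringKrullDim A ≤ n := by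
  obtain ⟨s, g, hinj, hfin⟩ := exists_finite_inj_algHom_of_fg k A
  let := g.toRingHom.toAlgebra
  have : Module.Finite (MvPolynomial (Fin s) k) A := hfin
  have hle : s ≤ n := by
    have hind : AlgebraicIndependent k (fun i : Fin s => algebraMap A F (g (MvPolynomial.X i)))
        := by
      have h0 := (MvPolynomial.algebraicIndependent_X (Fin s) k).map' (f := g) hinj
      exact h0.map' (f := IsScalarTower.toAlgHom k A F) (FaithfulSMul.algebraMap_injective A F)
    have h1 := hind.cardinalMk_le_trdeg.trans h
    simpa using h1
  refine (ringKrullDim_le_of_isIntegral (R := MvPolynomial (Fin s) k)).trans ?_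
  rw [MvPolynomial.ringKrullDim_of_isNoetherianRing]
  simp only [ringKrullDim_eq_zero_of_field, zero_add, Nat.card_eq_fintype_card, Fintype.card_fin]
  exact_mod_cast hle

end

section

open Module Polynomial

lemma exists_basis_of_isNilpotent {F V : Type} [Field F] [AddCommGroup V] [Module F V]
    [Module.Finite F V] (φ : End F V) (hφ : IsNilpotent φ) :
    ∃ (t : ℕ) (m : Fin t → ℕ) (b : Basis (Σ i, Fin (m i)) F V), ∀ i (j : Fin (m i)),
      φ (b ⟨i, j⟩) = if h : j + 1 < m i then b ⟨i, ⟨j + 1, h⟩⟩ else 0 := by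
  obtain ⟨N, hN⟩ := hφ
  have htors : Module.IsTorsion' (AEval' φ) (Submonoid.powers (X : F[X])) := by
    intro x
    refine ⟨⟨X ^ N, N, rfl⟩, ?_⟩
    obtain ⟨v, rfl⟩ := (AEval'.of φ).surjective x
    change (X ^ N : F[X]) • AEval'.of φ v = 0
    rw [AEval'.X_pow_smul_of, hN]
    simp
  obtain ⟨t, m, ⟨e⟩⟩ := torsion_by_prime_power_decomposition (irreducible_X (R := F)) htors
  let pb : ∀ i, PowerBasis F (AdjoinRoot (X ^ m i : F[X])) := fun i =>
    AdjoinRoot.powerBasis' (monic_X_pow (m i))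
  have hdim : ∀ i, (pb i).dim = m i := fun i => by simp [pb]
  let e1 : V ≃ₗ[F] (∀ i, F[X] ⧸ Submodule.span F[X] {(X : F[X]) ^ m i}) :=
    (AEval'.of φ).trans ((e.trans (DirectSum.linearEquivFunOnFintype F[X] (Fin t)
      (fun i => F[X] ⧸ Submodule.span F[X] {(X : F[X]) ^ m i}))).restrictScalars F)
  have he1 : ∀ v, e1 (φ v) = (X : F[X]) • e1 v := by
    intro v
    simp only [e1, LinearEquiv.trans_apply, LinearEquiv.restrictScalars_apply]
    rw [← map_smul, ← map_smul, AEval'.X_smul_of]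
  let C : ∀ i, Basis (Fin (m i)) F (F[X] ⧸ Submodule.span F[X] {(X : F[X]) ^ m i}) := fun i =>
    ((pb i).basis.reindex (finCongr (hdim i)) : Basis (Fin (m i)) F (AdjoinRoot (X ^ m i : F[X])))
  have hC : ∀ i (j : Fin (m i)), C i j = Submodule.Quotient.mk (X ^ (j : ℕ)) := by
    intro i j
    have h1 : C i j = (pb i).basis ((finCongr (hdim i)).symm j) :=
      Basis.reindex_apply (pb i).basis (finCongr (hdim i)) j
    exact h1.trans ((pb i).basis_eq_pow ((finCongr (hdim i)).symm j))
  let B : Basis (Σ i, Fin (m i)) F (∀ i, F[X] ⧸ Submodule.span F[X] {(X : F[X]) ^ m i}) :=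
    Pi.basis C
  have hB : ∀ i (j : Fin (m i)), B ⟨i, j⟩ = Pi.single i (Submodule.Quotient.mk (X ^ (j : ℕ))) := by
    intro i j
    rw [Pi.basis_apply, hC]
  refine ⟨t, m, B.map e1.symm, fun i j => ?_⟩
  apply e1.injective
  rw [he1]
  split_ifs with h
  · simp only [Basis.map_apply, LinearEquiv.apply_symm_apply, hB]
    rw [← Pi.single_smul, ← Submodule.Quotient.mk_smul, smul_eq_mul, ← pow_succ']
  · simp only [Basis.map_apply, LinearEquiv.apply_symm_apply, hB, map_zero]
    rw [← Pi.single_smul, ← Submodule.Quotient.mk_smul, smul_eq_mul, ← pow_succ',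
      (Submodule.Quotient.mk_eq_zero _).mpr, Pi.single_zero]
    exact Ideal.mem_span_singleton.mpr (pow_dvd_pow _ (by omega))

/-- The nilpotent matrix in Jordan form with blocks described by `e`. -/
def jordanNilp {n : Type} (e : n → ℕ × ℕ) (R : Type) [CommRing R] : Matrix n n R :=
  Matrix.of fun a b => if e a = ((e b).1, (e b).2 + 1) then 1 else 0

lemma exists_jordanNilp {F n : Type} [Field F] [Fintype n] [DecidableEq n] (N : Matrix n n F)
    (hN : IsNilpotent N) : ∃ (e : n → ℕ × ℕ) (g : Matrix n n F), Function.Injective e ∧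
      IsUnit g.det ∧ N * g = g * jordanNilp e F := by
  obtain ⟨t, m, b, hb⟩ := exists_basis_of_isNilpotent (Matrix.toLin' N)
    (hN.map (Matrix.toLinAlgEquiv' (R := F) (n := n)))
  let σ : n ≃ (Σ i, Fin (m i)) := (Pi.basisFun F n).indexEquiv b
  let e : n → ℕ × ℕ := fun a => ((σ a).1, (σ a).2)
  let b' : Basis n F (n → F) := b.reindex σ.symm
  have he : Function.Injective e := by
    intro a a' h
    apply σ.injective
    simp only [e, Prod.mk.injEq] at h
    generalize σ a = x at h
    generalize σ a' = y at h
    obtain ⟨i, j⟩ := x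
    obtain ⟨i', j'⟩ := y
    obtain ⟨h1, h2⟩ := h
    simp only at h1 h2
    have h1' := Fin.ext h1
    subst h1'
    rw [Fin.ext h2]
  have hes : ∀ i (j : Fin (m i)), e (σ.symm ⟨i, j⟩) = ((i : ℕ), (j : ℕ)) := by
    intro i j
    simp only [e]
    rw [Equiv.apply_symm_apply]
  refine ⟨e, (Pi.basisFun F n).toMatrix b', he, ?_, ?_⟩
  · have := (Pi.basisFun F n).invertibleToMatrix b'
    exact (Matrix.isUnit_iff_isUnit_det _).mp (isUnit_of_invertible _)
  · ext a c
    have h1 : (N * (Pi.basisFun F n).toMatrix b') a c = (Matrix.toLin' N (b' c)) a := by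
      simp [Matrix.mul_apply, Basis.toMatrix_apply, Matrix.mulVec, dotProduct]
    rw [h1, Matrix.mul_apply]
    simp only [b', Basis.reindex_apply, Equiv.symm_symm]
    have h2 := hb (σ c).1 (σ c).2
    rw [Sigma.eta] at h2
    rw [h2]
    split_ifs with h
    · rw [Finset.sum_eq_single (σ.symm ⟨(σ c).1, ⟨(σ c).2 + 1, h⟩⟩)]
      · simp only [jordanNilp, Matrix.of_apply, hes]
        simp [Basis.toMatrix_apply, e]
      · intro x _ hx
        have : e x ≠ ((e c).1, (e c).2 + 1) := by
          intro h3
          apply hx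
          apply he
          rw [h3, hes]
        simp [jordanNilp, this]
      · simp
    · rw [Finset.sum_eq_zero]
      · rfl
      · intro x _
        have : e x ≠ ((e c).1, (e c).2 + 1) := by
          intro h3
          apply h
          simp only [e, Prod.mk.injEq] at h3
          obtain ⟨h4, h5⟩ := h3
          rw [← h5, ← Fin.ext h4]
          exact (σ x).2.2
        simp [jordanNilp, this]

end

section

open Module Polynomial

lemma isNilpotent_of_mul_eq_smul_mul {F n : Type} [Field F] [Fintype n] [DecidableEq n]
    {Φ N : Matrix n n F} {q : F} (hq0 : q ≠ 0) (hq : ∀ i : ℕ, 0 < i → q ^ i ≠ 1)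
    (hΦ : IsUnit Φ.det) (h : N * Φ = q • (Φ * N)) : IsNilpotent N := by
  set m := minpoly F N with hm
  have hintg : IsIntegral F N := Algebra.IsIntegral.isIntegral N
  have hmon : m.Monic := minpoly.monic hintg
  have hconj : ∀ p : F[X], aeval N p * Φ = Φ * aeval (q • N) p := by
    intro p
    induction p using Polynomial.induction_on' with
    | add a b ha hb => simp [add_mul, mul_add, ha, hb]
    | monomial i a =>
      have hpow : N ^ i * Φ = Φ * (q • N) ^ i := by
        induction i with
        | zero => simp
        | succ i ih => rw [pow_succ, mul_assoc, h, pow_succ, ← Matrix.mul_smul, ← mul_assoc, ih,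
            mul_assoc]
      simp only [aeval_monomial, mul_assoc, hpow]
      rw [← mul_assoc, ← mul_assoc, Algebra.commutes]
  have h1 : aeval (q • N) m = 0 := by
    have := hconj m
    rw [hm, minpoly.aeval, zero_mul] at this
    have h2 := (Matrix.isUnit_iff_isUnit_det _).mpr hΦ
    exact (h2.mul_right_eq_zero).mp this.symm
  have h2 : aeval N (m.comp (C q * X)) = 0 := by
    rw [aeval_comp]
    simpa [Algebra.smul_def] using h1
  set n' := m.natDegree with hn'
  have h3 : m.comp (C q * X) - C (q ^ n') * m = 0 := by
    by_contra hne
    have h4 := minpoly.degree_le_of_ne_zero F N hne (by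
      rw [map_sub, h2, map_mul, hm, minpoly.aeval]; simp)
    rw [← hm, degree_eq_natDegree hmon.ne_zero, ← not_lt] at h4
    apply h4
    rw [degree_lt_iff_coeff_zero]
    intro i hi
    rw [coeff_sub, comp_C_mul_X_coeff, coeff_C_mul]
    rcases hi.eq_or_lt with rfl | hi
    · ring
    · rw [coeff_eq_zero_of_natDegree_lt hi]; simp
  have h5 : m = X ^ n' := by
    ext i
    rw [coeff_X_pow]
    split_ifs with hi
    · rw [hi]; exact hmon
    · rcases lt_or_gt_of_ne hi with hlt | hgt
      · have h6 := congrArg (fun p => coeff p i) h3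
        simp only [coeff_sub, comp_C_mul_X_coeff, coeff_C_mul, coeff_zero] at h6
        have h7 : m.coeff i * q ^ i * (1 - q ^ (n' - i)) = 0 := by
          have h9 : q ^ n' = q ^ i * q ^ (n' - i) := by
            rw [← pow_add, Nat.add_sub_cancel' hlt.le]
          rw [← h6, h9]; ring
        have h8 : 1 - q ^ (n' - i) ≠ 0 := fun h => hq (n' - i) (by omega) (sub_eq_zero.mp h).symm
        simpa [h8, hq0] using h7
      · exact coeff_eq_zero_of_natDegree_lt hgt
  refine ⟨n', ?_⟩
  have := minpoly.aeval F N
  rw [← hm, h5] at this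
  simpa using this

lemma exists_pivots {K W ι : Type} [Field K] [AddCommGroup W] [Module K W] [Fintype ι]
    [DecidableEq ι] (c : ι → Dual K W) (hc : ∀ v, (∀ i, c i v = 0) → v = 0) :
    ∃ (T : Finset ι) (b : ι → W), (∀ t ∈ T, ∀ t' ∈ T, c t' (b t) = if t = t' then 1 else 0) ∧
      (∀ v, (∀ t ∈ T, c t v = 0) → v = 0) ∧ ∀ v, v = ∑ t ∈ T, c t v • b t := by
  obtain ⟨T, hT, hmin⟩ := (Set.toFinite {T : Finset ι | ∀ v, (∀ t ∈ T, c t v = 0) → v = 0}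
    ).exists_minimal
    ⟨Finset.univ, fun v hv => hc v fun i => hv i (Finset.mem_univ i)⟩
  have hex : ∀ t ∈ T, ∃ v, (∀ t' ∈ T, c t' v = if t = t' then 1 else 0) := by
    intro t ht
    have : ¬ ∀ v, (∀ t' ∈ T.erase t, c t' v = 0) → v = 0 := fun h =>
      Finset.notMem_erase t T (hmin h (Finset.erase_subset t T) ht)
    push Not at this
    obtain ⟨v, hv, hv0⟩ := this
    have hvt : c t v ≠ 0 := by
      intro h0
      apply hv0
      apply hT
      intro t' ht'
      by_cases h : t' = t
      · rw [h, h0]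
      · exact hv t' (Finset.mem_erase.mpr ⟨h, ht'⟩)
    refine ⟨(c t v)⁻¹ • v, fun t' ht' => ?_⟩
    split_ifs with h
    · subst h
      simp [hvt]
    · rw [map_smul, hv t' (Finset.mem_erase.mpr ⟨fun h' => h h'.symm, ht'⟩), smul_zero]
  choose! b hb using hex
  refine ⟨T, b, hb, hT, fun v => ?_⟩
  rw [← sub_eq_zero]
  apply hT
  intro t ht
  rw [map_sub, map_sum, sub_eq_zero, Finset.sum_eq_single t]
  · simp [hb t ht t ht]
  · intro t' ht' hne
    simp [hb t' ht' t ht, hne]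
  · exact fun h => absurd ht h

/-- The discriminant of the characteristic polynomial of a matrix, as a resultant. -/
noncomputable def charDisc {n R : Type} [Fintype n] [DecidableEq n] [CommRing R] (M : Matrix n n R)
    : R :=
  resultant M.charpoly (derivative M.charpoly) (Fintype.card n) (Fintype.card n)

lemma charDisc_map {n R S : Type} [Fintype n] [DecidableEq n] [CommRing R] [CommRing S]
    (M : Matrix n n R) (φ : R →+* S) : charDisc (M.map φ) = φ (charDisc M) := by
  rw [charDisc, Matrix.charpoly_map, derivative_map, resultant_map_map, charDisc]

lemma isUnit_charDisc_iff {n R : Type} [Fintype n] [DecidableEq n] [CommRing R] [Nontrivial R]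
    (M : Matrix n n R) : IsUnit (charDisc M) ↔ M.charpoly.Separable := by
  rw [Polynomial.Separable, ← isUnit_resultant_iff_isCoprime M.charpoly_monic]
  have h1 : (derivative M.charpoly).natDegree ≤ Fintype.card n :=
    (natDegree_derivative_le _).trans (by rw [Matrix.charpoly_natDegree_eq_dim]; omega)
  obtain ⟨j, hj⟩ := Nat.exists_eq_add_of_le h1
  have h2 : charDisc M = resultant M.charpoly (derivative M.charpoly) := by
    unfold charDisc
    conv_lhs => arg 4; rw [hj]
    rw [resultant_add_right_deg _ _ _ _ j le_rfl, Matrix.charpoly_natDegree_eq_dim]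
    have : M.charpoly.coeff (Fintype.card n) = 1 := by
      have := M.charpoly_monic
      rwa [Monic, leadingCoeff, Matrix.charpoly_natDegree_eq_dim] at this
    rw [this]; simp
  rw [h2]

lemma charDisc_diagonal_ne_zero {n K : Type} [Fintype n] [DecidableEq n] [Field K] {w : n → K}
    (hw : Function.Injective w) : charDisc (Matrix.diagonal w) ≠ 0 := by
  rw [← isUnit_iff_ne_zero, isUnit_charDisc_iff, Matrix.charpoly_diagonal]
  exact (separable_prod_X_sub_C_iff).mpr hw

end

section

open Module Polynomial

lemma trdeg_le_of_adjoin_eq_top {k F ι : Type} [Field k] [Field F] [Algebra k F] [Fintype ι]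
    (u : ι → F) (hu : IntermediateField.adjoin k (Set.range u) = ⊤) :
    Algebra.trdeg k F ≤ Fintype.card ι ∧
      (¬ AlgebraicIndependent k u → Algebra.trdeg k F < Fintype.card ι) := by
  have halg : Algebra.IsAlgebraic (Algebra.adjoin k (Set.range u)) F := by
    rw [← IntermediateField.isAlgebraic_adjoin_iff_top, hu, Algebra.isAlgebraic_iff_isIntegral]
    exact Algebra.isIntegral_of_surjective IntermediateField.topEquiv.surjective
  constructor
  · refine (Algebra.IsAlgebraic.trdeg_le_cardinalMk k (Set.range u)).trans ?_
    refine Cardinal.mk_range_le.trans ?_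
    simp
  · intro hind
    by_contra hlt
    rw [not_lt] at hlt
    exact hind (Algebra.IsAlgebraic.isTranscendenceBasis_of_le_trdeg_of_finite k u
      (by simpa using hlt)).1

/-- A subspace of matrices over `F` containing an invertible matrix also contains one whose
pivot coordinates lie in the infinite subfield `k`. -/
lemma exists_isUnit_det_sum {k F n : Type} [Field k] [Infinite k] [Field F] [Algebra k F]
    [Fintype n] [DecidableEq n] (T : Finset (n × n)) (b : n × n → Matrix n n F)
    (y : n × n → F) (hy : IsUnit (∑ t ∈ T, y t • b t).det) :
    ∃ x : n × n → k, IsUnit (∑ t ∈ T, algebraMap k F (x t) • b t).det := by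
  let P : MvPolynomial (n × n) F :=
    (∑ t ∈ T, (MvPolynomial.X t : MvPolynomial (n × n) F) • (b t).map MvPolynomial.C).det
  have hP : ∀ z : n × n → F, MvPolynomial.eval z P = (∑ t ∈ T, z t • b t).det := by
    intro z
    simp only [P]
    rw [RingHom.map_det]
    congr 1
    ext i j
    simp [Matrix.sum_apply]
  have hP0 : P ≠ 0 := by
    intro h0
    rw [← hP, h0, map_zero] at hy
    exact not_isUnit_zero hy
  by_contra hcon
  push Not at hcon
  apply hP0
  refine MvPolynomial.funext_set (fun _ => Set.range (algebraMap k F))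
    (fun _ => Set.infinite_range_of_injective (algebraMap k F).injective) ?_
  intro z hz
  rw [map_zero]
  choose x hx using fun t => hz t trivial
  have := hcon x
  rw [hP]
  simpa [hx] using this

lemma trdeg_le_of_mul_eq_smul_mul_of_jordanNilp {k F n : Type} [Field k] [Infinite k] [Field F]
    [Algebra k F]
    [Fintype n] [DecidableEq n] {q : k} (hq0 : q ≠ 0) {e : n → ℕ × ℕ}
    {w : n → k} (hw : Function.Injective w) (hw0 : ∀ a, w a ≠ 0)
    (hwJ : ∀ a b, e a = ((e b).1, (e b).2 + 1) → w b = q * w a)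
    {Φ N : Matrix n n F} (h : N * Φ = algebraMap k F q • (Φ * N))
    (hgen : ∀ K : IntermediateField k F, (∀ a b, Φ a b ∈ K) → (∀ a b, N a b ∈ K) → K = ⊤)
    {g₀ : Matrix n n F} (hg₀ : IsUnit g₀.det) (hN : N * g₀ = g₀ * jordanNilp e F) :
    Algebra.trdeg k F ≤ (Fintype.card n ^ 2 : ℕ) ∧
      (charDisc Φ = 0 → Algebra.trdeg k F < (Fintype.card n ^ 2 : ℕ)) := by
  set J : Matrix n n k := jordanNilp e k with hJ
  set JF : Matrix n n F := jordanNilp e F with hJF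
  have hJmap : J.map (algebraMap k F) = JF := by
    ext a b
    simp only [hJ, hJF, jordanNilp, Matrix.map_apply, Matrix.of_apply]
    split_ifs <;> simp
  -- the spaces `V = {Ψ : J Ψ = q Ψ J}` over `k` and `U = {g : N g = g J}` over `F`
  let V : Submodule k (Matrix n n k) :=
    LinearMap.eqLocus (LinearMap.mulLeft k J) (q • LinearMap.mulRight k J)
  have hV : ∀ Ψ, Ψ ∈ V ↔ J * Ψ = q • (Ψ * J) := fun Ψ => by
    simp [V, LinearMap.mem_eqLocus]
  let U : Submodule F (Matrix n n F) :=
    LinearMap.eqLocus (LinearMap.mulLeft F N) (LinearMap.mulRight F JF)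
  have hU : ∀ g, g ∈ U ↔ N * g = g * JF := fun g => by
    simp [U, LinearMap.mem_eqLocus]
  obtain ⟨T, b, hb, hT, hexp⟩ := exists_pivots (W := V)
    (fun t : n × n => (Matrix.entryLinearMap k k t.1 t.2).comp V.subtype) (by
      intro v hv
      apply Subtype.ext
      ext i j
      exact hv (i, j))
  obtain ⟨T₁, b₁, hb₁, hT₁, hexp₁⟩ := exists_pivots (W := U)
    (fun t : n × n => (Matrix.entryLinearMap F F t.1 t.2).comp U.subtype) (by
      intro v hv
      apply Subtype.ext
      ext i j
      exact hv (i, j))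
  simp only [LinearMap.comp_apply, Matrix.entryLinearMap_apply, Submodule.subtype_apply]
    at hb hT hexp hb₁ hT₁ hexp₁
  have hbV : ∀ t, JF * (b t : Matrix n n k).map (algebraMap k F) =
      algebraMap k F q • ((b t : Matrix n n k).map (algebraMap k F) * JF) := by
    intro t
    have := congrArg (fun M => M.map (algebraMap k F)) ((hV _).mp (b t).2)
    simp only [Matrix.map_mul, hJmap] at this
    rw [this]
    ext i j
    rw [← hJmap, ← Matrix.map_mul]
    simp only [Matrix.map_apply, Matrix.smul_apply, smul_eq_mul, map_mul]
  -- comparison of dimensions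
  have hcard : T.card ≤ T₁.card := by
    let A : Matrix n n F := Matrix.diagonal fun a => algebraMap k F (w a)⁻¹
    have hA : A * JF = algebraMap k F q • (JF * A) := by
      ext i j
      simp only [A, Matrix.smul_apply, Matrix.diagonal_mul, Matrix.mul_diagonal, hJF, jordanNilp,
        Matrix.of_apply, smul_eq_mul]
      split_ifs with hij
      · rw [mul_one, one_mul, ← map_mul, hwJ i j hij, mul_inv, mul_inv_cancel_left₀ hq0]
      · simp
    have hAu : IsUnit A := by
      rw [Matrix.isUnit_iff_isUnit_det, Matrix.det_diagonal, isUnit_iff_ne_zero,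
        Finset.prod_ne_zero_iff]
      intro a _
      simpa using hw0 a
    have hg₀u : IsUnit g₀ := (Matrix.isUnit_iff_isUnit_det _).mpr hg₀
    let B : (T → F) →ₗ[F] Matrix n n F :=
      Fintype.linearCombination F fun t : T => (b t : Matrix n n k).map (algebraMap k F)
    have hB : ∀ y, B y = ∑ t : T, y t • (b t : Matrix n n k).map (algebraMap k F) :=
      fun y => Fintype.linearCombination_apply ..
    have hBJ : ∀ y, JF * B y = algebraMap k F q • (B y * JF) := by
      intro y
      rw [hB, Finset.mul_sum, Finset.sum_mul, Finset.smul_sum]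
      refine Finset.sum_congr rfl fun t _ => ?_
      rw [Matrix.mul_smul, hbV, Matrix.smul_mul, smul_comm]
    have hBinj : ∀ y, B y = 0 → y = 0 := by
      intro y hy
      ext t
      have := congrFun (congrFun hy t.1.1) t.1.2
      rw [hB, Matrix.sum_apply, Finset.sum_eq_single t] at this
      · simpa [hb t t.2 t t.2] using this
      · intro t' _ ht'
        have hne : (t' : n × n) ≠ t := fun h => ht' (Subtype.ext h)
        simp [hb t' t'.2 t t.2, hne]
      · simp
    let L : (T → F) →ₗ[F] (T₁ → F) := LinearMap.pi fun t =>
      (Matrix.entryLinearMap F F t.1.1 t.1.2).comp ((LinearMap.mulLeft F (g₀ * A)).comp B)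
    have hL : Function.Injective L := by
      rw [← LinearMap.ker_eq_bot, LinearMap.ker_eq_bot']
      intro y hy
      have hmem : g₀ * A * B y ∈ U := by
        rw [hU]
        calc N * (g₀ * A * B y) = g₀ * (JF * A) * B y := by simp only [← mul_assoc, hN]
          _ = g₀ * (A * B y * JF) := by
            have hqF : algebraMap k F q ≠ 0 := by simpa using hq0
            apply smul_right_injective _ hqF
            simp only
            rw [← Matrix.smul_mul, ← Matrix.mul_smul, ← hA, ← Matrix.mul_smul, mul_assoc A,
              ← Matrix.mul_smul, ← hBJ]
            simp only [mul_assoc]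
          _ = g₀ * A * B y * JF := by simp only [mul_assoc]
      have h0 := hT₁ ⟨_, hmem⟩ fun t ht => congrFun hy ⟨t, ht⟩
      have h1 : g₀ * A * B y = 0 := congrArg Subtype.val h0
      exact hBinj y (((hg₀u.mul hAu).mul_right_eq_zero).mp h1)
    simpa using LinearMap.finrank_le_finrank_of_injective hL
  -- a matrix `g ∈ U` whose pivot coordinates lie in `k`
  obtain ⟨x, hx⟩ := exists_isUnit_det_sum (k := k) T₁ (fun t => (b₁ t : Matrix n n F))
    (fun t => g₀ t.1 t.2) (by
      have := congrArg Subtype.val (hexp₁ ⟨g₀, (hU _).mpr hN⟩)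
      simp only [Submodule.coe_sum, Submodule.coe_smul] at this
      rwa [← this])
  set g : Matrix n n F := ∑ t ∈ T₁, algebraMap k F (x t) • (b₁ t : Matrix n n F) with hgdef
  have hgU : N * g = g * JF := by
    rw [← hU]
    exact U.sum_mem fun t _ => U.smul_mem _ (b₁ t).2
  have hgT : ∀ t ∈ T₁, g t.1 t.2 = algebraMap k F (x t) := by
    intro t ht
    rw [hgdef, Matrix.sum_apply, Finset.sum_eq_single t]
    · simp [hb₁ t ht t ht]
    · intro t' ht' hne
      simp [hb₁ t' ht' t ht, hne]
    · exact fun h => absurd ht h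
  have hgi : g * g⁻¹ = 1 := Matrix.mul_nonsing_inv _ hx
  have hig : g⁻¹ * g = 1 := Matrix.nonsing_inv_mul _ hx
  set Ψ : Matrix n n F := g⁻¹ * Φ * g with hΨdef
  have hgN : g⁻¹ * N = JF * g⁻¹ := by
    calc g⁻¹ * N = g⁻¹ * (N * g) * g⁻¹ := by simp only [mul_assoc, hgi, mul_one]
      _ = JF * g⁻¹ := by rw [hgU, ← mul_assoc, hig, one_mul]
  have hΨJ : JF * Ψ = algebraMap k F q • (Ψ * JF) := by
    calc JF * Ψ = g⁻¹ * (N * Φ) * g := by simp only [hΨdef, ← mul_assoc, hgN]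
      _ = algebraMap k F q • (g⁻¹ * Φ * (N * g)) := by
        rw [h, Matrix.mul_smul, Matrix.smul_mul]; simp only [mul_assoc]
      _ = algebraMap k F q • (Ψ * JF) := by rw [hgU]; simp only [hΨdef, mul_assoc]
  have hΨexp : Ψ = ∑ t ∈ T, Ψ t.1 t.2 • (b t : Matrix n n k).map (algebraMap k F) := by
    ext i j
    rw [← sub_eq_zero, ← Module.forall_dual_apply_eq_zero_iff k]
    intro φ
    have hmem : Ψ.map φ ∈ V := by
      rw [hV]
      ext a c
      have := congrArg φ (congrFun (congrFun hΨJ a) c)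
      simp only [← hJmap, Matrix.mul_apply, Matrix.smul_apply, smul_eq_mul, Matrix.map_apply,
        ← Algebra.smul_def,
        map_sum, map_smul, mul_comm _ (algebraMap k F _)] at this
      simpa only [Matrix.mul_apply, Matrix.smul_apply, Matrix.map_apply, smul_eq_mul, mul_comm]
          using this
    have := congrFun (congrFun (congrArg Subtype.val (hexp ⟨_, hmem⟩)) i) j
    simp only [Submodule.coe_sum, Submodule.coe_smul, Matrix.sum_apply, Matrix.smul_apply,
        Matrix.map_apply,
      smul_eq_mul] at this
    simp only [map_sub, Matrix.sum_apply, Matrix.smul_apply, Matrix.map_apply, smul_eq_mul, map_sum,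
      mul_comm _ (algebraMap k F _), ← Algebra.smul_def, map_smul, this, sub_eq_zero]
    simp only [mul_comm]
  -- the generators of `F`
  let u : ({t : n × n // t ∉ T₁} ⊕ T) → F :=
    Sum.elim (fun t => g t.1.1 t.1.2) (fun t => Ψ t.1.1 t.1.2)
  have hu : IntermediateField.adjoin k (Set.range u) = ⊤ := by
    set K := IntermediateField.adjoin k (Set.range u) with hK
    have hmemu : ∀ i, u i ∈ K := fun i => IntermediateField.subset_adjoin _ _ ⟨i, rfl⟩
    have hgK : ∀ a c, g a c ∈ K := by
      intro a c
      by_cases hac : (a, c) ∈ T₁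
      · rw [hgT (a, c) hac]
        exact K.algebraMap_mem _
      · exact hmemu (Sum.inl ⟨(a, c), hac⟩)
    have hΨK : ∀ a c, Ψ a c ∈ K := by
      intro a c
      rw [hΨexp, Matrix.sum_apply]
      refine sum_mem fun t ht => ?_
      exact mul_mem (hmemu (Sum.inr ⟨t, ht⟩)) (K.algebraMap_mem _)
    let gK : Matrix n n K := Matrix.of fun a c => ⟨g a c, hgK a c⟩
    have hgKmap : gK.map (algebraMap K F) = g := rfl
    have hmulK : ∀ M M' : Matrix n n F, (∀ a c, M a c ∈ K) → (∀ a c, M' a c ∈ K) →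
        ∀ a c, (M * M') a c ∈ K := fun M M' hM hM' a c =>
      sum_mem fun i _ => mul_mem (hM a i) (hM' i c)
    have hgK' : ∀ a c, g⁻¹ a c ∈ K := by
      have h1 : gK⁻¹.map (algebraMap K F) = g⁻¹ := by
        have hdet : IsUnit gK.det := by
          have : algebraMap K F gK.det = g.det := by
            rw [RingHom.map_det]; rfl
          rw [isUnit_iff_ne_zero]
          intro h0
          rw [← this, h0, map_zero] at hx
          exact not_isUnit_zero hx
        symm
        apply Matrix.inv_eq_right_inv
        conv_lhs => rw [← hgKmap]
        rw [← Matrix.map_mul, Matrix.mul_nonsing_inv _ hdet]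
        exact Matrix.map_one _ (map_zero _) (map_one _)
      intro a c
      rw [← h1]
      exact (gK⁻¹ a c).2
    apply hgen
    · have : Φ = g * Ψ * g⁻¹ := by
        simp only [hΨdef, ← mul_assoc, hgi, one_mul]
        simp only [mul_assoc, hgi, mul_one]
      rw [this]
      exact hmulK _ _ (hmulK _ _ hgK hΨK) hgK'
    · have : N = g * JF * g⁻¹ := by
        rw [← hgU, mul_assoc, hgi, mul_one]
      rw [this]
      refine hmulK _ _ (hmulK _ _ hgK ?_) hgK'
      intro a c
      rw [← hJmap]
      exact K.algebraMap_mem _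
  have hcardι : Fintype.card ({t : n × n // t ∉ T₁} ⊕ T) ≤ Fintype.card n ^ 2 := by
    rw [Fintype.card_sum, Fintype.card_subtype_compl, Fintype.card_coe, Fintype.card_prod]
    have : T₁.card ≤ Fintype.card n * Fintype.card n := by
      rw [← Fintype.card_prod]; exact T₁.card_le_univ
    have h5 : Fintype.card T = T.card := Fintype.card_coe T
    have h6 : Fintype.card {t : n × n // t ∈ T₁} = T₁.card := Fintype.card_coe T₁
    rw [sq]
    omega
  obtain ⟨h1, h2⟩ := trdeg_le_of_adjoin_eq_top u hu
  have h3 : (Fintype.card ({t : n × n // t ∉ T₁} ⊕ T) : Cardinal) ≤ (Fintype.card n ^ 2 : ℕ) := by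
    exact_mod_cast hcardι
  refine ⟨h1.trans h3, fun hdisc => (h2 ?_).trans_le h3⟩
  intro hind
  let R := MvPolynomial ({t : n × n // t ∉ T₁} ⊕ T) k
  let M : Matrix n n R :=
    ∑ t : T, (MvPolynomial.X (Sum.inr t) : R) • (b t : Matrix n n k).map MvPolynomial.C
  have hM : ∀ {S : Type} [CommRing S] [Algebra k S] (z : {t : n × n // t ∉ T₁} ⊕ T → S),
      M.map (MvPolynomial.aeval z : R →ₐ[k] S).toRingHom =
        ∑ t : T, z (Sum.inr t) • (b t : Matrix n n k).map (algebraMap k S) := by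
    intro S _ _ z
    ext i j
    simp [M, Matrix.sum_apply]
  have hG0 : charDisc M = 0 := by
    apply hind
    rw [map_zero]
    have : charDisc Φ = MvPolynomial.aeval u (charDisc M) := by
      have h4 : charDisc Φ = charDisc Ψ := by
        have hgu : IsUnit g := (Matrix.isUnit_iff_isUnit_det _).mpr hx
        have h5 := Matrix.charpoly_units_conj hgu.unit⁻¹ Φ
        simp only [Matrix.coe_units_inv, IsUnit.unit_spec, Matrix.nonsing_inv_nonsing_inv g hx]
          at h5
        rw [charDisc, charDisc, ← h5]
      rw [h4]
      change _ = (MvPolynomial.aeval u : R →ₐ[k] F).toRingHom (charDisc M)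
      rw [← charDisc_map, hM]
      conv_lhs => rw [hΨexp]
      rw [← Finset.sum_coe_sort]
      rfl
    rw [← this, hdisc]
  have hwV : Matrix.diagonal w ∈ V := by
    rw [hV]
    ext i j
    simp only [Matrix.smul_apply, Matrix.diagonal_mul, Matrix.mul_diagonal, hJ, jordanNilp,
        Matrix.of_apply, smul_eq_mul]
    split_ifs with hij
    · rw [mul_one, one_mul, hwJ i j hij]
    · simp
  have h6 := congrArg Subtype.val (hexp ⟨_, hwV⟩)
  simp only [Submodule.coe_sum, Submodule.coe_smul] at h6
  apply charDisc_diagonal_ne_zero hw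
  have h7 := hM (S := k) (Sum.elim 0 fun t => Matrix.diagonal w t.1.1 t.1.2)
  have h8 : Matrix.diagonal w = M.map (MvPolynomial.aeval
      (Sum.elim 0 fun t => Matrix.diagonal w t.1.1 t.1.2) : R →ₐ[k] k).toRingHom := by
    rw [h7]
    conv_lhs => rw [h6]
    rw [← Finset.sum_coe_sort]
    simp
  rw [h8, charDisc_map, hG0, map_zero]

end

lemma exists_weights (k : Type) [Field k] [CharZero k] {Q : ℕ} (hQ : 2 ≤ Q) :
    ∃ m : ℕ × ℕ → k, Function.Injective m ∧ (∀ a, m a ≠ 0) ∧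
      ∀ i j, m (i, j) = (Q : k) * m (i, j + 1) := by
  have hQ0 : (Q : k) ≠ 0 := by exact_mod_cast (by omega : Q ≠ 0)
  have hQ1 : (Q + 1 : k) ≠ 0 := by exact_mod_cast (by omega : Q + 1 ≠ 0)
  refine ⟨fun a => (Q + 1 : k) ^ a.1 / (Q : k) ^ a.2, ?_, ?_, ?_⟩
  · have key : ∀ i j i' j' : ℕ, i ≤ i' → (Q + 1) ^ i * Q ^ j' = (Q + 1) ^ i' * Q ^ j →
        i = i' ∧ j = j' := by
      intro i j i' j' hi h
      obtain ⟨c, rfl⟩ := Nat.exists_eq_add_of_le hi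
      rw [pow_add, mul_assoc] at h
      have h2 : Q ^ j' = (Q + 1) ^ c * Q ^ j := Nat.eq_of_mul_eq_mul_left (by positivity) h
      have hco : Nat.Coprime ((Q + 1) ^ c) (Q ^ j') := Nat.Coprime.pow _ _ (by simp)
      have h3 : (Q + 1) ^ c = 1 := hco.eq_one_of_dvd ⟨_, h2⟩
      have h4 : c = 0 := by
        by_contra hc
        have := Nat.one_lt_pow hc (by omega : 1 < Q + 1)
        omega
      rw [h3, one_mul] at h2
      exact ⟨by omega, (Nat.pow_right_injective hQ h2).symm⟩
    rintro ⟨i, j⟩ ⟨i', j'⟩ h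
    simp only at h
    rw [div_eq_div_iff (pow_ne_zero _ hQ0) (pow_ne_zero _ hQ0)] at h
    have h' : (Q + 1) ^ i * Q ^ j' = (Q + 1) ^ i' * Q ^ j := by exact_mod_cast h
    rcases le_total i i' with hi | hi
    · obtain ⟨h1, h2⟩ := key _ _ _ _ hi h'
      rw [h1, h2]
    · obtain ⟨h1, h2⟩ := key _ _ _ _ hi h'.symm
      rw [h1, h2]
  · intro a
    exact div_ne_zero (pow_ne_zero _ hQ1) (pow_ne_zero _ hQ0)
  · intro i j
    simp only [pow_succ]
    field_simp

noncomputable section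

/-- The generic invertible matrix `Φ`. -/
def genΦ (k n : Type) [Field k] : Matrix n n (MvPolynomial (Bool × n × n) k) :=
  Matrix.of fun a b => MvPolynomial.X (false, a, b)

/-- The generic matrix `N`. -/
def genN (k n : Type) [Field k] : Matrix n n (MvPolynomial (Bool × n × n) k) :=
  Matrix.of fun a b => MvPolynomial.X (true, a, b)

/-- The matrix `NΦ - qΦN`. -/
def commRel {k : Type} (n : Type) [Field k] [Fintype n] (q : k) :
    Matrix n n (MvPolynomial (Bool × n × n) k) :=
  genN k n * genΦ k n - (MvPolynomial.C q : MvPolynomial (Bool × n × n) k) • (genΦ k n * genN k n)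

/-- The ideal generated by the entries of `NΦ - qΦN`. -/
def commIdeal {k : Type} (n : Type) [Field k] [Fintype n] (q : k) :
    Ideal (MvPolynomial (Bool × n × n) k) :=
  Ideal.span (Set.range fun t : n × n => commRel n q t.1 t.2)

end

lemma commRel_map {k n S : Type} [Field k] [Fintype n] [CommRing S] [Algebra k S] (q : k)
    (φ : MvPolynomial (Bool × n × n) k →ₐ[k] S) :
    (commRel n q).map φ = (genN k n).map φ * (genΦ k n).map φ -
      algebraMap k S q • ((genΦ k n).map φ * (genN k n).map φ) := by
  ext a b
  simp [commRel, Matrix.mul_apply, ← MvPolynomial.algebraMap_eq, Algebra.smul_def]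

open MvPolynomial in
lemma trdeg_fractionRing_le {k n : Type} [Field k] [CharZero k] [Fintype n] [DecidableEq n]
    {Q : ℕ} (hQ : 2 ≤ Q) (P : Ideal (MvPolynomial (Bool × n × n) k)) [P.IsPrime]
    (hP : commIdeal n (Q : k) ≤ P) (hdet : (genΦ k n).det ∉ P) :
    Algebra.trdeg k (FractionRing (MvPolynomial (Bool × n × n) k ⧸ P)) ≤
        (Fintype.card n ^ 2 : ℕ) ∧
      (charDisc (genΦ k n) ∈ P →
        Algebra.trdeg k (FractionRing (MvPolynomial (Bool × n × n) k ⧸ P)) <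
          (Fintype.card n ^ 2 : ℕ)) := by
  set A := MvPolynomial (Bool × n × n) k ⧸ P with hA
  set F := FractionRing A with hF
  let φ : MvPolynomial (Bool × n × n) k →ₐ[k] F :=
    (IsScalarTower.toAlgHom k A F).comp (Ideal.Quotient.mkₐ k P)
  have hker : ∀ x, φ x = 0 ↔ x ∈ P := by
    intro x
    change algebraMap A F (Ideal.Quotient.mk P x) = 0 ↔ _
    rw [FaithfulSMul.algebraMap_eq_zero_iff, Ideal.Quotient.eq_zero_iff_mem]
  set Φ : Matrix n n F := (genΦ k n).map φ with hΦ
  set N : Matrix n n F := (genN k n).map φ with hN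
  have hQ0 : (Q : k) ≠ 0 := by exact_mod_cast (by omega : Q ≠ 0)
  have hΦdet : IsUnit Φ.det := by
    rw [isUnit_iff_ne_zero]
    intro h0
    apply hdet
    rw [← hker, ← h0, hΦ]
    exact AlgHom.map_det φ _
  have hrel : N * Φ = algebraMap k F (Q : k) • (Φ * N) := by
    have h0 : (commRel n (Q : k)).map φ = 0 := by
      ext a b
      exact (hker _).mpr (hP (Ideal.subset_span ⟨(a, b), rfl⟩))
    have h1 := commRel_map (Q : k) φ
    rw [h0] at h1
    exact (sub_eq_zero.mp h1.symm)
  have hnil : IsNilpotent N := by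
    refine isNilpotent_of_mul_eq_smul_mul (q := algebraMap k F (Q : k)) ?_ ?_ hΦdet hrel
    · rw [Ne, map_eq_zero]; exact hQ0
    · intro i hi h1
      rw [← map_pow, ← map_one (algebraMap k F)] at h1
      have h2 := (algebraMap k F).injective h1
      have h3 : Q ^ i = 1 := by exact_mod_cast h2
      have := Nat.one_lt_pow hi.ne' (by omega : 1 < Q)
      omega
  obtain ⟨e, g, he, hg, hJ⟩ := exists_jordanNilp N hnil
  obtain ⟨m, hm, hm0, hmq⟩ := exists_weights k hQ
  have key := trdeg_le_of_mul_eq_smul_mul_of_jordanNilp hQ0 (e := e) (w := fun a => m (e a))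
    (hm.comp he) (fun a => hm0 _) (fun a b hab => by
      simp only [hab]; rw [← hmq]) hrel (by
      intro K hK1 hK2
      have hφK : ∀ x, φ x ∈ K := by
        intro x
        induction x using MvPolynomial.induction_on with
        | C a =>
          have : φ (C a) = algebraMap k F a := φ.commutes a
          rw [this]; exact K.algebraMap_mem a
        | add p q hp hq => rw [map_add]; exact K.add_mem hp hq
        | mul_X p i hp =>
          rw [map_mul]
          refine K.mul_mem hp ?_
          obtain ⟨t, a, b⟩ := i
          cases t
          · exact hK1 a b
          · exact hK2 a b
      rw [eq_top_iff]
      intro x _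
      obtain ⟨a, b, hb, rfl⟩ := IsFractionRing.div_surjective (A := A) x
      obtain ⟨a, rfl⟩ := Ideal.Quotient.mk_surjective a
      obtain ⟨b, rfl⟩ := Ideal.Quotient.mk_surjective b
      exact K.div_mem (hφK a) (hφK b)) hg hJ
  refine ⟨key.1, fun hs => key.2 ?_⟩
  have : charDisc Φ = φ (charDisc (genΦ k n)) := charDisc_map (genΦ k n) φ.toRingHom
  rw [this, hker]
  exact hs

lemma ringKrullDim_quotient_le_of_commIdeal_le {k n : Type} [Field k] [CharZero k] [Fintype n]
    [DecidableEq n]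
    {Q : ℕ} (hQ : 2 ≤ Q) (P : Ideal (MvPolynomial (Bool × n × n) k)) [P.IsPrime]
    (hP : commIdeal n (Q : k) ≤ P) (hdet : (genΦ k n).det ∉ P) :
    ringKrullDim (MvPolynomial (Bool × n × n) k ⧸ P) ≤ (Fintype.card n ^ 2 : ℕ) ∧
      (charDisc (genΦ k n) ∈ P →
        ringKrullDim (MvPolynomial (Bool × n × n) k ⧸ P) < (Fintype.card n ^ 2 : ℕ)) := by
  obtain ⟨h1, h2⟩ := trdeg_fractionRing_le hQ P hP hdet
  refine ⟨ringKrullDim_le_of_trdeg_le h1, fun hs => ?_⟩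
  have h3 := h2 hs
  obtain ⟨t, ht⟩ := Cardinal.lt_aleph0.mp (h3.trans Cardinal.natCast_lt_aleph0)
  rw [ht] at h3
  have h4 : t < Fintype.card n ^ 2 := by exact_mod_cast h3
  refine (ringKrullDim_le_of_trdeg_le ht.le).trans_lt ?_
  exact_mod_cast h4

section

open IsLocalRing

lemma mem_of_charDisc_mul_mem_localization {k n : Type} [Field k] [CharZero k] [Fintype n]
    [DecidableEq n] {Q : ℕ} (hQ : 2 ≤ Q) (M : Ideal (MvPolynomial (Bool × n × n) k)) [M.IsMaximal]
    (hI : commIdeal n (Q : k) ≤ M) (hdet : (genΦ k n).det ∉ M) {x : Localization.AtPrime M}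
    (hx : algebraMap _ (Localization.AtPrime M) (charDisc (genΦ k n)) * x ∈
      (commIdeal n (Q : k)).map (algebraMap _ (Localization.AtPrime M))) :
    x ∈ (commIdeal n (Q : k)).map (algebraMap _ (Localization.AtPrime M)) := by
  let B := MvPolynomial (Bool × n × n) k
  let L := Localization.AtPrime M
  set I := commIdeal n (Q : k) with hIdef
  let fs : List L := (Finset.univ : Finset (n × n)).toList.map
    fun t => algebraMap B L (commRel n (Q : k) t.1 t.2)
  have hfsI : Ideal.ofList fs = I.map (algebraMap B L) := by
    rw [hIdef, commIdeal, Ideal.map_span, Ideal.ofList]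
    congr 1
    ext y
    simp [fs]
  have hmem : ∀ r ∈ fs, r ∈ I.map (algebraMap B L) := fun r hr => by
    rw [← hfsI]; exact Ideal.subset_span hr
  have hlen : fs.length = Fintype.card n ^ 2 := by
    simp [fs, sq]
  have hdim : ∀ P : Ideal L, P.IsPrime → I.map (algebraMap B L) ≤ P →
      ringKrullDim (L ⧸ P) ≤ (Fintype.card n ^ 2 : ℕ) ∧
      (algebraMap B L (charDisc (genΦ k n)) ∈ P →
        ringKrullDim (L ⧸ P) < (Fintype.card n ^ 2 : ℕ)) := by
    intro P hP hIP
    have h1 := ringKrullDim_localization_quotient_le M.primeCompl P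
    have hPM : P.comap (algebraMap B L) ≤ M := by
      intro y hy
      have := le_maximalIdeal hP.ne_top hy
      exact (IsLocalization.AtPrime.to_map_mem_maximal_iff L M y).mp this
    have h2 := ringKrullDim_quotient_le_of_commIdeal_le hQ (P.comap (algebraMap B L))
      (Ideal.map_le_iff_le_comap.mp hIP) (fun h => hdet (hPM h))
    exact ⟨h1.trans h2.1, fun hs => h1.trans_lt (h2.2 hs)⟩
  by_contra hxI
  set K : Submodule L L := Ideal.ofList fs • (⊤ : Submodule L L) with hK
  have hKI : ∀ y, y ∈ K ↔ y ∈ I.map (algebraMap B L) := fun y => by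
    rw [hK, hfsI]; simp
  obtain ⟨P, hPass, hP⟩ := exists_le_isAssociatedPrime_of_isNoetherianRing L (M := L ⧸ K)
    (K.mkQ x) (by
      rw [Ne, Submodule.mkQ_apply, Submodule.Quotient.mk_eq_zero, hKI]
      exact hxI)
  have hsP : algebraMap B L (charDisc (genΦ k n)) ∈ P := by
    apply hP
    rw [Submodule.mem_colon_singleton, Submodule.mem_bot, ← map_smul, Submodule.mkQ_apply,
      Submodule.Quotient.mk_eq_zero, hKI]
    exact hx
  have hIP : I.map (algebraMap B L) ≤ P := by
    refine le_trans ?_ hPass.annihilator_le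
    intro r hr
    rw [Submodule.mem_annihilator]
    intro m _
    obtain ⟨m, rfl⟩ := K.mkQ_surjective m
    rw [← map_smul, Submodule.mkQ_apply, Submodule.Quotient.mk_eq_zero, hKI]
    exact Ideal.mul_mem_right _ _ hr
  refine absurd ((hdim P hPass.isPrime hIP).2 hsP) (not_lt.mpr ?_)
  refine le_ringKrullDim_of_isAssociatedPrime_quotient (Fintype.card n ^ 2) fs ?_ (M := L) ?_ ?_
    hPass
  · intro r hr
    refine (?_ : I.map (algebraMap B L) ≤ maximalIdeal L) (hmem r hr)
    rw [← Localization.AtPrime.map_eq_maximalIdeal]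
    exact Ideal.map_mono hI
  · obtain ⟨rs, h1, h2, h3⟩ := exists_isRegular_localization_mvPolynomial M
    refine ⟨rs, ?_, h2, h3⟩
    rw [h1, hlen]
    simp
    ring
  · intro P' hP' _ hfP'
    refine (hdim P' hP' ?_).1
    rw [← hfsI, Ideal.ofList, Ideal.span_le]
    exact hfP'

lemma exists_det_pow_mul_mem_commIdeal {k n : Type} [Field k] [CharZero k] [Fintype n]
    [DecidableEq n] {Q : ℕ} (hQ : 2 ≤ Q) {x : MvPolynomial (Bool × n × n) k} {a b : ℕ}
    (hx : charDisc (genΦ k n) ^ a * ((genΦ k n).det ^ b * x) ∈ commIdeal n (Q : k)) :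
    ∃ c : ℕ, (genΦ k n).det ^ c * x ∈ commIdeal n (Q : k) := by
  let B := MvPolynomial (Bool × n × n) k
  set I := commIdeal n (Q : k) with hIdef
  let J : Ideal B := I.colon {x}
  have hJ : ∀ r, r ∈ J ↔ r * x ∈ I := fun r => Submodule.mem_colon_singleton
  suffices h : (genΦ k n).det ∈ J.radical by
    obtain ⟨c, hc⟩ := h
    exact ⟨c, (hJ _).mp hc⟩
  rw [Ideal.radical_eq_jacobson, Ideal.jacobson, Ideal.mem_sInf]
  rintro M ⟨hJM, hM⟩
  by_contra hdet
  have hIM : I ≤ M := le_trans (fun r hr => (hJ r).mpr (I.mul_mem_right _ hr)) hJM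
  let L := Localization.AtPrime M
  have h1 : ∀ a, algebraMap B L (charDisc (genΦ k n)) ^ a *
      algebraMap B L ((genΦ k n).det ^ b * x) ∈ I.map (algebraMap B L) →
      algebraMap B L ((genΦ k n).det ^ b * x) ∈ I.map (algebraMap B L) := by
    intro a
    induction a with
    | zero => intro h; simpa using h
    | succ a ih =>
      intro h
      rw [pow_succ', mul_assoc] at h
      exact ih (mem_of_charDisc_mul_mem_localization hQ M hIM hdet h)
  have h2 := h1 a (by
    rw [← map_pow, ← map_mul]
    exact Ideal.mem_map_of_mem _ hx)
  rw [IsLocalization.algebraMap_mem_map_algebraMap_iff M.primeCompl] at h2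
  obtain ⟨m, hm, h3⟩ := h2
  rw [← mul_assoc] at h3
  have h4 := hJM ((hJ _).mpr h3)
  rcases (inferInstance : M.IsPrime).mem_or_mem h4 with h5 | h5
  · exact hm h5
  · exact hdet ((inferInstance : M.IsPrime).mem_of_pow_mem _ h5)

end

section
open MvPolynomial

lemma coeff_eval₂Hom_ite {R S ι : Type} [CommRing R] [CommRing S] [DecidableEq ι] (φ : R →+* S)
    (s : Finset ι) {α : ι →₀ ℕ} (hα : α.support ⊆ s) (x : MvPolynomial ι R) :
    coeff α (eval₂Hom (C.comp φ) (fun i => if i ∈ s then (X i : MvPolynomial ι S) else 0) x) =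
      φ (coeff α x) := by
  induction x using MvPolynomial.induction_on' with
  | add p q hp hq => simp only [map_add, coeff_add, hp, hq]
  | monomial β a =>
    rw [coe_eval₂Hom, eval₂_monomial]
    by_cases hβ : β.support ⊆ s
    · have : (β.prod fun i e => (if i ∈ s then (X i : MvPolynomial ι S) else 0) ^ e) =
          β.prod fun i e => (X i : MvPolynomial ι S) ^ e := by
        refine Finset.prod_congr rfl fun i hi => ?_
        beta_reduce
        rw [if_pos (hβ hi)]
      rw [this, RingHom.comp_apply, ← monomial_eq, coeff_monomial, coeff_monomial]
      split_ifs <;> simp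
    · obtain ⟨i, hi, his⟩ := Finset.not_subset.mp hβ
      have : (β.prod fun i e => (if i ∈ s then (X i : MvPolynomial ι S) else 0) ^ e) = 0 := by
        refine Finset.prod_eq_zero hi ?_
        beta_reduce
        rw [if_neg his, zero_pow (Finsupp.mem_support_iff.mp hi)]
      rw [this, mul_zero, coeff_zero, coeff_monomial, if_neg, map_zero]
      rintro rfl
      exact hβ hα

lemma isRadical_span_X_mul_C {R ι : Type} [CommRing R] [DecidableEq ι] (l : ι → R)
    (hl : ∀ s : Set ι, (Ideal.span (l '' s)).IsRadical) :
    (Ideal.span (Set.range fun i => X i * C (l i)) : Ideal (MvPolynomial ι R)).IsRadical := by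
  set K : Ideal (MvPolynomial ι R) := Ideal.span (Set.range fun i => X i * C (l i)) with hK
  rintro x ⟨m, hm⟩
  have key : ∀ α : ι →₀ ℕ, coeff α x ∈ Ideal.span (l '' α.support) := by
    intro α
    set J := Ideal.span (l '' α.support) with hJ
    have hred : IsReduced (R ⧸ J) := (Ideal.isRadical_iff_quotient_reduced J).mp (hl _)
    rw [← Ideal.Quotient.eq_zero_iff_mem, ← coeff_eval₂Hom_ite (Ideal.Quotient.mk J) α.support
      subset_rfl]
    set ψ := eval₂Hom (C.comp (Ideal.Quotient.mk J))
      (fun i => if i ∈ α.support then (X i : MvPolynomial ι (R ⧸ J)) else 0) with hψ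
    have hKψ : K ≤ RingHom.ker ψ := by
      rw [hK, Ideal.span_le]
      rintro _ ⟨i, rfl⟩
      rw [SetLike.mem_coe, RingHom.mem_ker, map_mul, hψ, coe_eval₂Hom, eval₂_X, eval₂_C]
      split_ifs with hi
      · rw [RingHom.comp_apply, Ideal.Quotient.eq_zero_iff_mem.mpr, C_0, mul_zero]
        exact Ideal.subset_span ⟨i, hi, rfl⟩
      · rw [zero_mul]
    have h0 : ψ x ^ m = 0 := by
      rw [← map_pow]
      exact hKψ hm
    rw [eq_zero_of_pow_eq_zero h0, coeff_zero]
  rw [x.as_sum]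
  refine Ideal.sum_mem _ fun α _ => ?_
  have hle : Ideal.span (l '' α.support) ≤
      Submodule.comap (monomial α) (K.restrictScalars R) := by
    rw [Ideal.span, Submodule.span_le]
    rintro _ ⟨i, hi, rfl⟩
    change monomial α (l i) ∈ K
    have : monomial α (l i) = monomial (α - Finsupp.single i 1) 1 * (X i * C (l i)) := by
      rw [X, C_apply, monomial_mul, monomial_mul, one_mul, one_mul, add_zero,
        tsub_add_cancel_of_le]
      rw [Finsupp.single_le_iff]
      exact Nat.one_le_iff_ne_zero.mpr (Finsupp.mem_support_iff.mp hi)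
    rw [this]
    exact K.mul_mem_left _ (Ideal.subset_span ⟨i, rfl⟩)
  exact hle (key α)

lemma isRadical_span_linearForms {k n : Type} [Field k] [Fintype n] [DecidableEq n]
    (s : Set (n → k)) :
    (Ideal.span ((fun v : n → k => ∑ a, C (v a) * X a) '' s) : Ideal (MvPolynomial n k)).IsRadical
        := by
  let ℓ : (n → k) →ₗ[k] MvPolynomial n k :=
    { toFun := fun v => ∑ a, C (v a) * X a
      map_add' := fun v w => by simp [add_mul, Finset.sum_add_distrib]
      map_smul' := fun c v => by simp [Finset.smul_sum, smul_eq_C_mul, mul_assoc] }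
  set J : Ideal (MvPolynomial n k) := Ideal.span ((fun v : n → k => ∑ a, C (v a) * X a) '' s)
      with hJ
  let W := Submodule.span k s
  have hWJ : ∀ v ∈ W, ℓ v ∈ J := by
    have : W ≤ Submodule.comap ℓ (J.restrictScalars k) := by
      rw [Submodule.span_le]
      exact fun v hv => Ideal.subset_span ⟨v, hv, rfl⟩
    exact fun v hv => this hv
  obtain ⟨σ, hσ⟩ := W.mkQ.exists_rightInverse_of_surjective W.range_mkQ
  let π := σ ∘ₗ W.mkQ
  have hπ : ∀ v, ℓ v - ℓ (π v) ∈ J := by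
    intro v
    rw [← map_sub]
    apply hWJ
    rw [← Submodule.ker_mkQ W, LinearMap.mem_ker, map_sub, sub_eq_zero]
    exact (LinearMap.congr_fun hσ (W.mkQ v)).symm
  let θ : MvPolynomial n k →ₐ[k] MvPolynomial n k := aeval fun a => ℓ (π (Pi.single a 1))
  have hθ : ∀ v, θ (ℓ v) = ℓ (π v) := by
    intro v
    have h1 : v = ∑ a, v a • (Pi.single a 1 : n → k) := by
      ext b; simp [Finset.sum_apply, Pi.single_apply]
    conv_rhs => rw [h1]
    simp only [map_sum, map_smul]
    simp [ℓ, θ, smul_eq_C_mul, MvPolynomial.algebraMap_eq]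
  have hℓX : ∀ a, ℓ (Pi.single a 1) = X a := fun a => by
    simp [ℓ, Pi.single_apply]
  have hmod : ∀ x, x - θ x ∈ J := by
    intro x
    have : (Ideal.Quotient.mkₐ k J).comp θ = Ideal.Quotient.mkₐ k J := by
      ext a
      simp only [θ, AlgHom.comp_apply, aeval_X, Ideal.Quotient.mkₐ_eq_mk]
      rw [← hℓX a, eq_comm, Ideal.Quotient.eq]
      exact hπ _
    rw [← Ideal.Quotient.eq]
    exact (AlgHom.congr_fun this x).symm
  have hker : J ≤ RingHom.ker θ := by
    rw [hJ, Ideal.span_le]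
    rintro _ ⟨v, hv, rfl⟩
    change θ (ℓ v) = 0
    rw [hθ]
    have : W.mkQ v = 0 := by
      rw [← LinearMap.mem_ker, Submodule.ker_mkQ]; exact Submodule.subset_span hv
    simp [π, this]
  rintro x ⟨m, hm⟩
  have h0 : θ x ^ m = 0 := by
    rw [← map_pow]; exact hker hm
  have := hmod x
  rwa [eq_zero_of_pow_eq_zero h0, sub_zero] at this

end

section
open Polynomial

lemma exists_mul_diagonal {L n : Type} [CommRing L] [IsLocalRing L] [Fintype n] [DecidableEq n]
    (Φ : Matrix n n L) (l : n → L) (hchar : Φ.charpoly = ∏ i, (X - C (l i)))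
    (hsep : Φ.charpoly.Separable) :
    ∃ g : Matrix n n L, IsUnit g.det ∧ Φ * g = g * Matrix.diagonal l := by
  set r := IsLocalRing.residue L with hr
  have hinj : Function.Injective fun i => r (l i) := by
    have h1 := hsep.map (f := r)
    rw [hchar, Polynomial.map_prod] at h1
    simp only [Polynomial.map_sub, Polynomial.map_X, Polynomial.map_C] at h1
    exact (separable_prod_X_sub_C_iff (f := fun i => r (l i))).mp h1
  have hchar' : (Φ.map r).charpoly = ∏ i, (X - C (r (l i))) := by
    rw [Matrix.charpoly_map, hchar, Polynomial.map_prod]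
    simp
  have hw : ∀ i, ∃ w : n → L, (Φ.map r).mulVec (r ∘ w) = r (l i) • (r ∘ w) ∧ r ∘ w ≠ 0 := by
    intro i
    have hroot : (Φ.map r).charpoly.IsRoot (r (l i)) := by
      rw [hchar', IsRoot, eval_prod]
      exact Finset.prod_eq_zero (Finset.mem_univ i) (by simp)
    have hev : Module.End.HasEigenvalue (Matrix.toLin' (Φ.map r)) (r (l i)) := by
      rw [Module.End.hasEigenvalue_iff_isRoot_charpoly, Matrix.charpoly_toLin']
      exact hroot
    obtain ⟨w, hw⟩ := hev.exists_hasEigenvector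
    choose w' hw' using fun a => IsLocalRing.residue_surjective (w a)
    have : r ∘ w' = w := funext hw'
    refine ⟨w', ?_, ?_⟩
    · rw [this]; simpa using hw.apply_eq_smul
    · rw [this]; exact hw.2
  choose w hw1 hw2 using hw
  let E : n → L[X] := fun i => ∏ j ∈ Finset.univ.erase i, (X - C (l j))
  have hE : ∀ i, (X - C (l i)) * E i = Φ.charpoly := fun i => by
    rw [hchar]; exact Finset.mul_prod_erase _ _ (Finset.mem_univ i)
  let v : n → n → L := fun i => (aeval Φ (E i)).mulVec (w i)
  have hv : ∀ i, Φ.mulVec (v i) = l i • v i := by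
    intro i
    have h0 : (aeval Φ ((X - C (l i)) * E i)).mulVec (w i) = 0 := by
      rw [hE, Matrix.aeval_self_charpoly, Matrix.zero_mulVec]
    rw [map_mul, ← Matrix.mulVec_mulVec, map_sub, aeval_X, aeval_C, Matrix.sub_mulVec,
      sub_eq_zero, Algebra.algebraMap_eq_smul_one, Matrix.smul_mulVec, Matrix.one_mulVec] at h0
    exact h0
  have hvr : ∀ i, r ∘ v i = (∏ j ∈ Finset.univ.erase i, (r (l i) - r (l j))) • (r ∘ w i) := by
    intro i
    have h1 : ∀ s : Finset n, (aeval (Φ.map r) (∏ j ∈ s, (X - C (r (l j))))).mulVec (r ∘ w i) =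
        (∏ j ∈ s, (r (l i) - r (l j))) • (r ∘ w i) := by
      intro s
      induction s using Finset.induction_on with
      | empty => simp
      | insert j s hj ih =>
        rw [Finset.prod_insert hj, Finset.prod_insert hj, map_mul, ← Matrix.mulVec_mulVec, ih,
          Matrix.mulVec_smul, map_sub, aeval_X, aeval_C, Matrix.sub_mulVec, hw1,
          Algebra.algebraMap_eq_smul_one, Matrix.smul_mulVec, Matrix.one_mulVec, ← sub_smul,
          smul_smul, mul_comm]
    rw [← h1]
    have h2 : (aeval Φ (E i)).map r = aeval (Φ.map r) (∏ j ∈ Finset.univ.erase i, (X - C (r (l j))))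
        := by
      have : (∏ j ∈ Finset.univ.erase i, (X - C (r (l j)))) = (E i).map r := by
        simp [E, Polynomial.map_prod]
      rw [this, aeval_def, aeval_def, eval₂_map]
      change r.mapMatrix _ = _
      rw [hom_eval₂]
      congr 1
      ext a b c
      simp [Matrix.algebraMap_matrix_apply]
      split_ifs <;> simp
    rw [← h2]
    ext a
    simp [v, Matrix.mulVec, dotProduct]
  refine ⟨Matrix.of fun a i => v i a, ?_, ?_⟩
  · rw [← IsLocalRing.residue_ne_zero_iff_isUnit, RingHom.map_det, ← isUnit_iff_ne_zero,
      ← Matrix.isUnit_iff_isUnit_det, ← Matrix.linearIndependent_cols_iff_isUnit]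
    refine Module.End.eigenvectors_linearIndependent' (Matrix.toLin' (Φ.map r))
      (fun i => r (l i)) hinj _ fun i => ?_
    have hcol : (r.mapMatrix (Matrix.of fun a i => v i a)).col i = r ∘ v i := rfl
    rw [hcol, hvr]
    refine ⟨?_, ?_⟩
    · rw [Module.End.mem_eigenspace_iff, Matrix.toLin'_apply, Matrix.mulVec_smul, hw1,
        smul_comm]
    · refine smul_ne_zero ?_ (hw2 i)
      rw [Finset.prod_ne_zero_iff]
      intro j hj
      rw [sub_ne_zero]
      exact fun h => (Finset.ne_of_mem_erase hj) (hinj h).symm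
  · ext a i
    rw [Matrix.mul_diagonal]
    have := congrFun (hv i) a
    simpa [Matrix.mulVec, dotProduct, Matrix.mul_apply, mul_comm] using this

end

open MvPolynomial in
lemma exists_universal_isUnit_det (k m n D : Type) [Field k] [Fintype m] [Fintype n]
    [DecidableEq n] [CommRing D] [Algebra k D] [IsReduced D] :
    ∃ (W : Type) (_ : CommRing W) (_ : Algebra k W) (_ : IsReduced W) (ι : D →ₐ[k] W)
      (g : m → Matrix n n W), (∀ i, IsUnit (g i).det) ∧
      ∀ (L : Type) [CommRing L] [Algebra k L] (φ : D →ₐ[k] L) (g' : m → Matrix n n L),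
        (∀ i, IsUnit (g' i).det) →
          ∃ ρ : W →ₐ[k] L, ρ.comp ι = φ ∧ ∀ i, (g i).map ρ = g' i := by
  let G : m → Matrix n n (MvPolynomial (m × n × n) D) := fun i =>
    Matrix.of fun a b => X (i, a, b)
  let Δ := ∏ i, (G i).det
  refine ⟨Localization.Away Δ, inferInstance, inferInstance,
    isReduced_localizationPreserves (Submonoid.powers Δ) _ inferInstance,
    (IsScalarTower.toAlgHom k (MvPolynomial (m × n × n) D) _).comp
      (IsScalarTower.toAlgHom k D (MvPolynomial (m × n × n) D)),
    fun i => (G i).map (algebraMap _ (Localization.Away Δ)), fun i => ?_, ?_⟩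
  · have : ((G i).map (algebraMap _ (Localization.Away Δ))).det = algebraMap _ _ (G i).det :=
      (RingHom.map_det (algebraMap (MvPolynomial (m × n × n) D) (Localization.Away Δ)) (G i)).symm
    rw [this]
    refine isUnit_of_dvd_unit (map_dvd _ (Finset.dvd_prod_of_mem (fun i => (G i).det)
      (Finset.mem_univ i))) (IsLocalization.Away.algebraMap_isUnit Δ)
  · intro L _ _ φ g' hg'
    let ψ : MvPolynomial (m × n × n) D →ₐ[k] L := aevalTower φ fun t => g' t.1 t.2.1 t.2.2
    have hψ : ∀ i, (G i).map ψ = g' i := by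
      intro i
      ext a b
      simp [G, ψ]
    have hu : ∀ y : Submonoid.powers Δ, IsUnit (ψ y) := by
      rintro ⟨_, e, rfl⟩
      have : ψ Δ = ∏ i, (g' i).det := by
        simp only [Δ, map_prod]
        refine Finset.prod_congr rfl fun i _ => ?_
        rw [← hψ]
        exact AlgHom.map_det ψ (G i)
      change IsUnit (ψ (Δ ^ e))
      rw [map_pow, this]
      exact (IsUnit.prod_univ_iff.mpr hg').pow e
    let ρ : Localization.Away Δ →ₐ[k] L :=
      IsLocalization.liftAlgHom (M := Submonoid.powers Δ) (f := ψ) hu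
    have hρ : ∀ y, ρ (algebraMap _ _ y) = ψ y := fun y => by
      simp [ρ]
    refine ⟨ρ, ?_, fun i => ?_⟩
    · ext y
      simp [hρ, ψ, MvPolynomial.algebraMap_eq]
    · ext a b
      simp only [Matrix.map_apply, hρ]
      rw [← hψ, Matrix.map_apply]

open MvPolynomial in
lemma exists_universal_diagonalization {k : Type} (n : Type) [Field k] [Fintype n] [DecidableEq n]
    (q : k) :
    ∃ (W : Type) (_ : CommRing W) (_ : Algebra k W) (_ : IsReduced W) (l : n → W)
      (ν g : Matrix n n W), IsUnit g.det ∧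
      (∀ i j, ν i j * (l j - algebraMap k W q * l i) = 0) ∧
      ∀ (L : Type) [CommRing L] [Algebra k L] (l' : n → L) (ν' g' : Matrix n n L),
        IsUnit g'.det → (∀ i j, ν' i j * (l' j - algebraMap k L q * l' i) = 0) →
        ∃ ρ : W →ₐ[k] L, ρ ∘ l = l' ∧ ν.map ρ = ν' ∧ g.map ρ = g' := by
  let c : n × n → MvPolynomial n k := fun t => X t.2 - C q * X t.1
  let K : Ideal (MvPolynomial (n × n) (MvPolynomial n k)) :=
    Ideal.span (Set.range fun t => X t * C (c t))
  have hK : K.IsRadical := by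
    refine isRadical_span_X_mul_C c fun s => ?_
    have h1 := isRadical_span_linearForms (k := k)
      ((fun t : n × n => (Pi.single t.2 1 - q • Pi.single t.1 1 : n → k)) '' s)
    have h2 : ∀ t : n × n, (∑ a, C ((Pi.single t.2 1 - q • Pi.single t.1 1 : n → k) a) * X a :
        MvPolynomial n k) = c t := by
      intro t
      simp [c, Pi.single_apply, sub_mul, Finset.sum_sub_distrib, apply_ite C, ite_mul]
    rw [Set.image_image] at h1
    simp only [h2] at h1
    exact h1
  have : IsReduced (MvPolynomial (n × n) (MvPolynomial n k) ⧸ K) :=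
    (Ideal.isRadical_iff_quotient_reduced K).mp hK
  obtain ⟨W, _, _, hW, ι, g, hg, huniv⟩ :=
    exists_universal_isUnit_det k Unit n (MvPolynomial (n × n) (MvPolynomial n k) ⧸ K)
  let δ : MvPolynomial (n × n) (MvPolynomial n k) →ₐ[k] W := ι.comp (Ideal.Quotient.mkₐ k K)
  refine ⟨W, inferInstance, inferInstance, hW, fun i => δ (C (X i)),
    Matrix.of fun i j => δ (X (i, j)), g (), hg (), ?_, ?_⟩
  · intro i j
    have hq : algebraMap k W q = δ (C (C q)) := (δ.commutes q).symm
    rw [hq, Matrix.of_apply, ← map_mul, ← map_sub, ← map_mul, ← C_mul, ← C_sub]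
    change ι (Ideal.Quotient.mk K (X (i, j) * C (c (i, j)))) = 0
    rw [Ideal.Quotient.eq_zero_iff_mem.mpr, map_zero]
    exact Ideal.subset_span ⟨(i, j), rfl⟩
  · intro L _ _ l' ν' g' hg' hν'
    let f₁ : MvPolynomial n k →ₐ[k] L := aeval l'
    let f₂ : MvPolynomial (n × n) (MvPolynomial n k) →ₐ[k] L := aevalTower f₁ fun t => ν' t.1 t.2
    have hf₂ : ∀ a ∈ K, f₂ a = 0 := by
      have : K ≤ RingHom.ker f₂ := by
        rw [Ideal.span_le]
        rintro _ ⟨t, rfl⟩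
        simp only [SetLike.mem_coe, RingHom.mem_ker, map_mul, f₂, aevalTower_X, aevalTower_C, c,
          f₁, map_sub, aeval_X, aeval_C]
        exact hν' _ _
      exact this
    obtain ⟨ρ, hρ, hρg⟩ := huniv L (Ideal.Quotient.liftₐ K f₂ hf₂) (fun _ => g') fun _ => hg'
    have hρδ : ∀ y, ρ (δ y) = f₂ y := fun y => by
      have := AlgHom.congr_fun hρ (Ideal.Quotient.mk K y)
      exact this
    refine ⟨ρ, ?_, ?_, hρg ()⟩
    · ext i
      simp [hρδ, f₂, f₁]
    · ext i j
      simp [hρδ, f₂]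

lemma eq_zero_of_charpoly_eq_prod {k n L : Type} [Field k] [Fintype n] [DecidableEq n] {q : k}
    [CommRing L] [IsLocalRing L] (φ : MvPolynomial (Bool × n × n) k →+* L)
    (hI : commIdeal n q ≤ RingHom.ker φ) {l : n → L}
    (hchar : ((genΦ k n).map φ).charpoly = ∏ i, (Polynomial.X - Polynomial.C (l i)))
    (hsep : ((genΦ k n).map φ).charpoly.Separable)
    {x : MvPolynomial (Bool × n × n) k} (hx : x ∈ (commIdeal n q).radical) : φ x = 0 := by
  let _ : Algebra k L := (φ.comp MvPolynomial.C).toAlgebra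
  let φ' : MvPolynomial (Bool × n × n) k →ₐ[k] L := { φ with commutes' := fun _ => rfl }
  set Φ := (genΦ k n).map φ with hΦ
  set N := (genN k n).map φ with hN
  obtain ⟨g, hg, hgΦ⟩ := exists_mul_diagonal Φ l hchar hsep
  have hgi : g * g⁻¹ = 1 := Matrix.mul_nonsing_inv _ hg
  have hgi' : g⁻¹ * g = 1 := Matrix.nonsing_inv_mul _ hg
  have hrel : N * Φ = algebraMap k L q • (Φ * N) := by
    have h0 : (commRel n q).map φ' = 0 := by
      ext a b
      exact hI (Ideal.subset_span ⟨(a, b), rfl⟩)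
    rw [commRel_map] at h0
    exact sub_eq_zero.mp h0
  have hΦg : Φ = g * Matrix.diagonal l * g⁻¹ := by
    rw [← hgΦ, mul_assoc, hgi, mul_one]
  set ν := g⁻¹ * N * g with hν
  have hNg : N = g * ν * g⁻¹ := by
    rw [hν, ← mul_assoc, ← mul_assoc, hgi, one_mul, mul_assoc, hgi, mul_one]
  have hν0 : ∀ i j, ν i j * (l j - algebraMap k L q * l i) = 0 := by
    have h1 : ν * Matrix.diagonal l = algebraMap k L q • (Matrix.diagonal l * ν) := by
      have h2 : Matrix.diagonal l = g⁻¹ * Φ * g := by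
        rw [mul_assoc, hgΦ, ← mul_assoc, hgi', one_mul]
      have h3 : ν * (g⁻¹ * Φ * g) = g⁻¹ * (N * Φ) * g := by
        calc ν * (g⁻¹ * Φ * g) = g⁻¹ * N * (g * g⁻¹) * Φ * g := by simp only [hν, mul_assoc]
          _ = _ := by rw [hgi]; simp only [mul_one, mul_assoc]
      have h4 : g⁻¹ * Φ * g * ν = g⁻¹ * (Φ * N) * g := by
        calc g⁻¹ * Φ * g * ν = g⁻¹ * Φ * (g * g⁻¹) * N * g := by simp only [hν, mul_assoc]
          _ = _ := by rw [hgi]; simp only [mul_one, mul_assoc]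
      rw [h2, h3, h4, hrel, Matrix.mul_smul, Matrix.smul_mul]
    intro i j
    have h2 := congrFun (congrFun h1 i) j
    rw [Matrix.mul_diagonal, Matrix.smul_apply, Matrix.diagonal_mul, smul_eq_mul] at h2
    linear_combination h2
  obtain ⟨W, _, _, _, lW, νW, gW, hgW, hνW, huniv⟩ := exists_universal_diagonalization n q
  obtain ⟨ρ, hρl, hρν, hρg⟩ := huniv L l ν g hg hν0
  have hgWi : gW * gW⁻¹ = 1 := Matrix.mul_nonsing_inv _ hgW
  have hgWi' : gW⁻¹ * gW = 1 := Matrix.nonsing_inv_mul _ hgW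
  set ΦW := gW * Matrix.diagonal lW * gW⁻¹ with hΦW
  set NW := gW * νW * gW⁻¹ with hNW
  let ψ : MvPolynomial (Bool × n × n) k →ₐ[k] W :=
    MvPolynomial.aeval fun t => if t.1 then NW t.2.1 t.2.2 else ΦW t.2.1 t.2.2
  have hψΦ : (genΦ k n).map ψ = ΦW := by
    ext a b
    simp [genΦ, ψ]
  have hψN : (genN k n).map ψ = NW := by
    ext a b
    simp [genN, ψ]
  have hψI : commIdeal n q ≤ RingHom.ker ψ := by
    rw [commIdeal, Ideal.span_le]
    rintro _ ⟨t, rfl⟩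
    have h0 : (commRel n q).map ψ = 0 := by
      rw [commRel_map, hψΦ, hψN, sub_eq_zero]
      have h1 : νW * Matrix.diagonal lW = algebraMap k W q • (Matrix.diagonal lW * νW) := by
        ext i j
        rw [Matrix.mul_diagonal, Matrix.smul_apply, Matrix.diagonal_mul, smul_eq_mul]
        linear_combination hνW i j
      have h3 : NW * ΦW = gW * (νW * Matrix.diagonal lW) * gW⁻¹ := by
        calc NW * ΦW = gW * νW * (gW⁻¹ * gW) * Matrix.diagonal lW * gW⁻¹ := by
              simp only [hNW, hΦW, mul_assoc]
          _ = _ := by rw [hgWi']; simp only [mul_one, mul_assoc]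
      have h4 : ΦW * NW = gW * (Matrix.diagonal lW * νW) * gW⁻¹ := by
        calc ΦW * NW = gW * Matrix.diagonal lW * (gW⁻¹ * gW) * νW * gW⁻¹ := by
              simp only [hNW, hΦW, mul_assoc]
          _ = _ := by rw [hgWi']; simp only [mul_one, mul_assoc]
      rw [h3, h4, h1, Matrix.mul_smul, Matrix.smul_mul]
    exact congrFun (congrFun h0 t.1) t.2
  have hψx : ψ x = 0 := by
    obtain ⟨m, hm⟩ := hx
    have h0 : ψ x ^ m = 0 := by
      rw [← map_pow]
      exact hψI hm
    exact eq_zero_of_pow_eq_zero h0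
  have hinv : gW⁻¹.map ρ = g⁻¹ := by
    symm
    apply Matrix.inv_eq_right_inv
    conv_lhs => rw [← hρg]
    rw [← Matrix.map_mul, hgWi]
    exact Matrix.map_one _ (map_zero _) (map_one _)
  have hφ' : φ' = ρ.comp ψ := by
    ext ⟨t, a, b⟩
    have hdiag : (Matrix.diagonal lW).map ρ = Matrix.diagonal l := by
      rw [Matrix.diagonal_map (map_zero ρ)]
      rw [← hρl]
      rfl
    cases t
    · have h1 : ΦW.map ρ = Φ := by
        rw [hΦW, Matrix.map_mul, Matrix.map_mul, hdiag, hρg, hinv, ← hΦg]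
      simp only [AlgHom.comp_apply, ψ, MvPolynomial.aeval_X]
      exact (congrFun (congrFun h1 a) b).symm
    · have h1 : NW.map ρ = N := by
        rw [hNW, Matrix.map_mul, Matrix.map_mul, hρν, hρg, hinv, ← hNg]
      simp only [AlgHom.comp_apply, ψ, MvPolynomial.aeval_X]
      exact (congrFun (congrFun h1 a) b).symm
  change φ' x = 0
  rw [hφ', AlgHom.comp_apply, hψx, map_zero]

open Polynomial in
lemma exists_charpoly_eq_prod_of_splits {n R : Type} [CommRing R] [Nontrivial R] [Fintype n]
    [DecidableEq n] (M : Matrix n n R) (h : M.charpoly.Splits) :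
    ∃ l : n → R, M.charpoly = ∏ i, (X - C (l i)) := by
  obtain ⟨m, hm⟩ := splits_iff_exists_multiset.mp h
  rw [M.charpoly_monic.leadingCoeff, C_1, one_mul] at hm
  have hcard : m.toList.length = Fintype.card n := by
    rw [Multiset.length_toList, ← natDegree_multiset_prod_X_sub_C_eq_card, ← hm,
      Matrix.charpoly_natDegree_eq_dim]
  let e : n ≃ Fin m.toList.length := (Fintype.equivFin n).trans (finCongr hcard.symm)
  refine ⟨fun i => m.toList.get (e i), ?_⟩
  rw [hm, e.prod_comp (fun j => X - C (m.toList.get j)), ← List.prod_ofFn]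
  conv_lhs => rw [← m.coe_toList]
  rw [Multiset.map_coe, Multiset.prod_coe]
  congr 1
  apply List.ext_getElem <;> simp

lemma exists_charDisc_pow_mul_mem {k n : Type} [Field k] [Fintype n] [DecidableEq n] {q : k}
    {x : MvPolynomial (Bool × n × n) k} (hx : x ∈ (commIdeal n q).radical) :
    ∃ a : ℕ, charDisc (genΦ k n) ^ a * x ∈ commIdeal n q := by
  let A := MvPolynomial (Bool × n × n) k ⧸ commIdeal n q
  let mk : MvPolynomial (Bool × n × n) k →+* A := Ideal.Quotient.mk _
  let s : A := mk (charDisc (genΦ k n))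
  let S := Localization.Away s
  suffices h : algebraMap A S (mk x) = 0 by
    rw [IsLocalization.map_eq_zero_iff (Submonoid.powers s)] at h
    obtain ⟨⟨_, a, rfl⟩, ha⟩ := h
    refine ⟨a, ?_⟩
    rw [← Ideal.Quotient.eq_zero_iff_mem, map_mul, map_pow]
    exact ha
  rcases subsingleton_or_nontrivial S with hS | hS
  · exact Subsingleton.elim _ _
  set Φ := (genΦ k n).map ((algebraMap A S).comp mk) with hΦ
  obtain ⟨T, _, _, _, _, _, hT⟩ := Φ.charpoly_monic.exists_splits_map
  have hinj : Function.Injective (algebraMap S T) := FaithfulSMul.algebraMap_injective S T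
  rw [← Matrix.charpoly_map] at hT
  obtain ⟨l, hl⟩ := exists_charpoly_eq_prod_of_splits _ hT
  rw [← map_eq_zero_iff _ hinj]
  refine eq_zero_of_localization _ fun J _ => ?_
  let φ : MvPolynomial (Bool × n × n) k →+* Localization.AtPrime J :=
    (algebraMap T (Localization.AtPrime J)).comp
      ((algebraMap S T).comp ((algebraMap A S).comp mk))
  have hφ : (genΦ k n).map φ =
      (Φ.map (algebraMap S T)).map (algebraMap T (Localization.AtPrime J)) := rfl
  refine eq_zero_of_charpoly_eq_prod (q := q) (l := algebraMap T (Localization.AtPrime J) ∘ l)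
    φ ?_ ?_ ?_ hx
  · intro y hy
    have : mk y = 0 := Ideal.Quotient.eq_zero_iff_mem.mpr hy
    simp [φ, this]
  · rw [hφ, Matrix.charpoly_map, hl, Polynomial.map_prod]
    simp
  · rw [← isUnit_charDisc_iff, charDisc_map]
    exact (IsLocalization.Away.algebraMap_isUnit s).map
      ((algebraMap T (Localization.AtPrime J)).comp (algebraMap S T))

lemma exists_det_pow_mul_mem_commIdeal_of_radical {k n : Type} [Field k] [CharZero k] [Fintype n]
    [DecidableEq n] {Q : ℕ} (hQ : 2 ≤ Q) {x : MvPolynomial (Bool × n × n) k}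
    (hx : x ∈ (commIdeal n (Q : k)).radical) :
    ∃ e : ℕ, (genΦ k n).det ^ e * x ∈ commIdeal n (Q : k) := by
  obtain ⟨a, ha⟩ := exists_charDisc_pow_mul_mem hx
  have ha' : charDisc (genΦ k n) ^ a * ((genΦ k n).det ^ 0 * x) ∈ commIdeal n (Q : k) := by
    rw [pow_zero, one_mul]
    exact ha
  exact exists_det_pow_mul_mem_commIdeal hQ (x := x) (a := a) (b := 0) ha'

lemma isReduced_away_mk {R : Type} [CommRing R] {I : Ideal R} {D : R}
    (h : ∀ x ∈ I.radical, ∃ e : ℕ, D ^ e * x ∈ I) :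
    IsReduced (Localization.Away (Ideal.Quotient.mk I D)) := by
  refine ⟨fun y hy => ?_⟩
  obtain ⟨z, s, rfl⟩ :=
    IsLocalization.exists_mk'_eq (Submonoid.powers (Ideal.Quotient.mk I D)) y
  obtain ⟨x, rfl⟩ := Ideal.Quotient.mk_surjective z
  rw [IsLocalization.mk'_eq_zero_iff]
  have h1 := (Commute.all _ (algebraMap _ (Localization.Away (Ideal.Quotient.mk I D))
    (s : R ⧸ I))).isNilpotent_mul_right hy
  rw [IsLocalization.mk'_spec] at h1
  obtain ⟨m, hm⟩ := h1
  rw [← map_pow, IsLocalization.map_eq_zero_iff (Submonoid.powers (Ideal.Quotient.mk I D))] at hm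
  obtain ⟨⟨_, c, rfl⟩, hc⟩ := hm
  have hrad : D * x ∈ I.radical := by
    refine ⟨c + m, ?_⟩
    have h2 : D ^ c * x ^ m ∈ I := by
      rw [← Ideal.Quotient.eq_zero_iff_mem, map_mul, map_pow, map_pow]
      exact hc
    have h3 := I.mul_mem_left (D ^ m * x ^ c) h2
    convert h3 using 1
    ring
  obtain ⟨e, he⟩ := h _ hrad
  refine ⟨⟨_, e + 1, rfl⟩, ?_⟩
  have h4 : Ideal.Quotient.mk I (D ^ (e + 1) * x) = 0 := by
    rw [Ideal.Quotient.eq_zero_iff_mem, pow_succ, mul_assoc]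
    exact he
  rwa [map_mul, map_pow] at h4

lemma exists_universal_comm {k : Type} (n : Type) [Field k] [CharZero k] [Fintype n]
    [DecidableEq n] {Q : ℕ} (hQ : 2 ≤ Q) :
    ∃ (W : Type) (_ : CommRing W) (_ : Algebra k W) (_ : IsReduced W) (Φ N : Matrix n n W),
      IsUnit Φ.det ∧ N * Φ = (Q : W) • (Φ * N) ∧
      ∀ (L : Type) [CommRing L] [Algebra k L] (Φ' N' : Matrix n n L),
        IsUnit Φ'.det → N' * Φ' = (Q : L) • (Φ' * N') →
        ∃ ρ : W →ₐ[k] L, Φ.map ρ = Φ' ∧ N.map ρ = N' := by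
  let I := commIdeal n (Q : k)
  let D : MvPolynomial (Bool × n × n) k ⧸ I := Ideal.Quotient.mk I (genΦ k n).det
  have hred : IsReduced (Localization.Away D) :=
    isReduced_away_mk fun _ hx => exists_det_pow_mul_mem_commIdeal_of_radical hQ hx
  let ι : MvPolynomial (Bool × n × n) k →ₐ[k] Localization.Away D :=
    (IsScalarTower.toAlgHom k (MvPolynomial (Bool × n × n) k ⧸ I) (Localization.Away D)).comp
      (Ideal.Quotient.mkₐ k I)
  refine ⟨Localization.Away D, inferInstance, inferInstance, hred, (genΦ k n).map ι,
    (genN k n).map ι, ?_, ?_, ?_⟩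
  · have : ((genΦ k n).map ι).det = ι (genΦ k n).det := (AlgHom.map_det ι _).symm
    rw [this]
    exact IsLocalization.Away.algebraMap_isUnit D
  · have h0 : (commRel n (Q : k)).map ι = 0 := by
      ext a b
      have h1 : Ideal.Quotient.mk I (commRel n (Q : k) a b) = 0 :=
        Ideal.Quotient.eq_zero_iff_mem.mpr (Ideal.subset_span ⟨(a, b), rfl⟩)
      simp [ι, h1]
    rw [commRel_map, sub_eq_zero, map_natCast] at h0
    exact h0
  · intro L _ _ Φ' N' hΦ' hrel
    let ψ : MvPolynomial (Bool × n × n) k →ₐ[k] L :=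
      MvPolynomial.aeval fun t => if t.1 then N' t.2.1 t.2.2 else Φ' t.2.1 t.2.2
    have hψΦ : (genΦ k n).map ψ = Φ' := by
      ext a b
      simp [genΦ, ψ]
    have hψN : (genN k n).map ψ = N' := by
      ext a b
      simp [genN, ψ]
    have hψI : ∀ a ∈ I, ψ a = 0 := by
      have : I ≤ RingHom.ker ψ := by
        change commIdeal n (Q : k) ≤ _
        rw [commIdeal, Ideal.span_le]
        rintro _ ⟨t, rfl⟩
        have h0 : (commRel n (Q : k)).map ψ = 0 := by
          rw [commRel_map, hψΦ, hψN, sub_eq_zero, map_natCast, hrel]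
        exact congrFun (congrFun h0 t.1) t.2
      exact this
    let ψ' : (MvPolynomial (Bool × n × n) k ⧸ I) →ₐ[k] L := Ideal.Quotient.liftₐ I ψ hψI
    have hu : ∀ y : Submonoid.powers D, IsUnit (ψ' y) := by
      rintro ⟨_, e, rfl⟩
      have : ψ' D = Φ'.det := by
        rw [← hψΦ]
        exact AlgHom.map_det ψ _
      change IsUnit (ψ' (D ^ e))
      rw [map_pow, this]
      exact hΦ'.pow e
    let ρ : Localization.Away D →ₐ[k] L :=
      IsLocalization.liftAlgHom (M := Submonoid.powers D) (f := ψ') hu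
    have hρ : ∀ y, ρ (ι y) = ψ y := fun y => by
      simp only [ρ, ι, AlgHom.comp_apply, IsScalarTower.toAlgHom_apply,
          IsLocalization.liftAlgHom_apply,
        IsLocalization.lift_eq]
      rfl
    refine ⟨ρ, ?_, ?_⟩
    · rw [← hψΦ]; ext a b
      exact hρ _
    · rw [← hψN]; ext a b
      exact hρ _

lemma Matrix.map_nonsing_inv_of_isUnit_det {n R S : Type} [Fintype n] [DecidableEq n] [CommRing R]
    [CommRing S] (ρ : R →+* S) {G : Matrix n n R} (h : IsUnit G.det) :
    (G⁻¹).map ρ = (G.map ρ)⁻¹ := by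
  refine (Matrix.inv_eq_left_inv ?_).symm
  rw [← Matrix.map_mul, Matrix.nonsing_inv_mul _ h, Matrix.map_one _ ρ.map_zero ρ.map_one]

lemma Fin.ofNat_succ_sub_one (f : ℕ) [NeZero f] (j : ℕ) :
    Fin.ofNat f (j + 1) - 1 = Fin.ofNat f j := by
  rw [sub_eq_iff_eq_add]
  ext
  simp [Fin.val_add, Fin.ofNat]

lemma Fin.val_sub_one_add_one_of_ne_zero {f : ℕ} [NeZero f] {i : Fin f} (hi : i ≠ 0) :
    (i - 1).val + 1 = i.val := by
  have h0 : i.val ≠ 0 := fun h => hi (Fin.ext h)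
  have h := Fin.ofNat_succ_sub_one f (i.val - 1)
  rw [Nat.sub_add_cancel (Nat.one_le_iff_ne_zero.mpr h0), Fin.ofNat_val_eq_self] at h
  rw [h, Fin.val_ofNat, Nat.mod_eq_of_lt (by omega)]
  omega

lemma Fin.val_zero_sub_one_add_one (f : ℕ) [NeZero f] : ((0 : Fin f) - 1).val + 1 = f := by
  have hf := NeZero.pos f
  have h := Fin.ofNat_succ_sub_one f (f - 1)
  have h' : Fin.ofNat f (f - 1 + 1) = 0 := by
    ext
    simp [Nat.sub_add_cancel hf]
  rw [h'] at h
  rw [h, Fin.val_ofNat, Nat.mod_eq_of_lt (by omega)]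
  omega

/-- The product `X_j ⋯ X_2 X_1`, with indices read modulo `f`. -/
def cyclicProd {M : Type} [Monoid M] {f : ℕ} [NeZero f] (X : Fin f → M) : ℕ → M
  | 0 => 1
  | j + 1 => X (Fin.ofNat f (j + 1)) * cyclicProd X j

section

variable {n R : Type} [Fintype n] [DecidableEq n] [CommRing R] {f : ℕ} [NeZero f]

lemma isUnit_det_cyclicProd {X : Fin f → Matrix n n R} (hX : ∀ i, IsUnit (X i).det) (j : ℕ) :
    IsUnit (cyclicProd X j).det := by
  induction j with
  | zero => simp [cyclicProd]
  | succ j ih =>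
    rw [cyclicProd, Matrix.det_mul]
    exact (hX _).mul ih

lemma mul_cyclicProd {q : R} {X Y : Fin f → Matrix n n R}
    (h : ∀ i, q • (X i * Y (i - 1)) = Y i * X i) (j : ℕ) :
    Y (Fin.ofNat f j) * cyclicProd X j = q ^ j • (cyclicProd X j * Y 0) := by
  induction j with
  | zero => simp [cyclicProd]
  | succ j ih =>
    rw [cyclicProd, ← mul_assoc, ← h, Fin.ofNat_succ_sub_one, smul_mul_assoc, mul_assoc, ih,
      mul_smul_comm, smul_smul, ← pow_succ', mul_assoc]

lemma twist_relation {q : R} {Φ N : Matrix n n R} (h : N * Φ = q ^ f • (Φ * N)) (i : Fin f) :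
    q ^ ((i - 1).val + 1) • ((if i = 0 then Φ else 1) * N) =
      q ^ i.val • (N * if i = 0 then Φ else 1) := by
  split_ifs with hi
  · subst hi
    rw [Fin.val_zero_sub_one_add_one, h]
    simp
  · rw [Fin.val_sub_one_add_one_of_ne_zero hi, one_mul, mul_one]

lemma conj_twist_relation {q : R} {Φ N : Matrix n n R} (h : N * Φ = q ^ f • (Φ * N))
    {G : Fin f → Matrix n n R} (hG : ∀ i, IsUnit (G i).det) (i : Fin f) :
    q • ((G i * (if i = 0 then Φ else 1) * (G (i - 1))⁻¹) *
        (q ^ (i - 1).val • (G (i - 1) * N * (G (i - 1))⁻¹))) =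
      (q ^ i.val • (G i * N * (G i)⁻¹)) * (G i * (if i = 0 then Φ else 1) * (G (i - 1))⁻¹) := by
  have h1 : (G i * (if i = 0 then Φ else 1) * (G (i - 1))⁻¹) * (G (i - 1) * N * (G (i - 1))⁻¹) =
      G i * ((if i = 0 then Φ else 1) * N) * (G (i - 1))⁻¹ := by
    rw [mul_assoc (G (i - 1)), mul_assoc _ (G (i - 1))⁻¹, Matrix.nonsing_inv_mul_cancel_left _ _
      (hG _)]
    simp only [mul_assoc]
  have h2 : (G i * N * (G i)⁻¹) * (G i * (if i = 0 then Φ else 1) * (G (i - 1))⁻¹) =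
      G i * (N * (if i = 0 then Φ else 1)) * (G (i - 1))⁻¹ := by
    rw [mul_assoc (G i) (if i = 0 then Φ else 1), mul_assoc _ (G i)⁻¹,
      Matrix.nonsing_inv_mul_cancel_left _ _ (hG _)]
    simp only [mul_assoc]
  rw [mul_smul_comm, smul_mul_assoc, smul_smul, ← pow_succ', h1, h2, ← smul_mul_assoc,
    ← mul_smul_comm, twist_relation h, mul_smul_comm, smul_mul_assoc]

lemma cyclicProd_mul_inv {X : Fin f → Matrix n n R} (hX : ∀ i, IsUnit (X i).det) (i : Fin f) :
    cyclicProd X i.val * (if i = 0 then cyclicProd X f else 1) *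
      (cyclicProd X (i - 1).val)⁻¹ = X i := by
  split_ifs with hi
  · subst hi
    have h := Fin.val_zero_sub_one_add_one f
    have h' : cyclicProd X f = X 0 * cyclicProd X ((0 : Fin f) - 1).val := by
      refine (congrArg (cyclicProd X) h.symm).trans ?_
      rw [cyclicProd, h]
      congr 2
      ext
      simp
    rw [h', Fin.val_zero, cyclicProd, one_mul,
      Matrix.mul_nonsing_inv_cancel_right _ _ (isUnit_det_cyclicProd hX _)]
  · have h := Fin.val_sub_one_add_one_of_ne_zero hi
    conv_lhs => rw [← h]
    rw [cyclicProd, h, mul_one, Fin.ofNat_val_eq_self,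
      Matrix.mul_nonsing_inv_cancel_right _ _ (isUnit_det_cyclicProd hX _)]

end

/-- An algebra carrying the universal cyclic family `(X_i, Y_i)` is reduced. -/
lemma isReduced_of_universal_cyclic {k : Type} [Field k] [CharZero k] {n : Type} [Fintype n]
    [DecidableEq n] {f : ℕ} [NeZero f] {p : ℕ} (hp : 2 ≤ p) {T : Type} [CommRing T] [Algebra k T]
    (X Y : Fin f → Matrix n n T) (hX : ∀ i, IsUnit (X i).det)
    (hXY : ∀ i, (p : T) • (X i * Y (i - 1)) = Y i * X i)
    (hgen : ∀ α : T →ₐ[k] T, (∀ i, (X i).map α = X i) → (∀ i, (Y i).map α = Y i) →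
      α = AlgHom.id k T)
    (huniv : ∀ (W : Type) [CommRing W] [Algebra k W] (X' Y' : Fin f → Matrix n n W),
      (∀ i, IsUnit (X' i).det) → (∀ i, (p : W) • (X' i * Y' (i - 1)) = Y' i * X' i) →
      ∃ α : T →ₐ[k] W, (∀ i, (X i).map α = X' i) ∧ ∀ i, (Y i).map α = Y' i) :
    IsReduced T := by
  have hQ : 2 ≤ p ^ f := hp.trans (Nat.le_self_pow (NeZero.ne f) p)
  obtain ⟨W₁, _, _, _, Φ₁, N₁, hΦ₁, hrel₁, hW₁⟩ := exists_universal_comm (k := k) n hQ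
  obtain ⟨W, _, _, _, ι, G, hG, hW⟩ := exists_universal_isUnit_det k (Fin f) n W₁
  set Φ := Φ₁.map ι with hΦdef
  set N := N₁.map ι with hNdef
  have hΦ : IsUnit Φ.det := by
    rw [hΦdef, ← AlgHom.mapMatrix_apply, ← AlgHom.map_det]
    exact hΦ₁.map ι
  have hrel : N * Φ = (p : W) ^ f • (Φ * N) := by
    rw [hNdef, hΦdef, ← Matrix.map_mul, hrel₁]
    ext a b
    simp [← Matrix.map_mul]
  obtain ⟨α, hαX, hαY⟩ := huniv W
    (fun i => G i * (if i = 0 then Φ else 1) * (G (i - 1))⁻¹)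
    (fun i => (p : W) ^ i.val • (G i * N * (G i)⁻¹))
    (fun i => by
      rw [Matrix.det_mul, Matrix.det_mul]
      refine ((hG i).mul ?_).mul (Matrix.isUnit_nonsing_inv_det _ (hG _))
      split_ifs
      · exact hΦ
      · simp)
    (conj_twist_relation hrel hG)
  obtain ⟨ρ₁, hρΦ, hρN⟩ := hW₁ T (cyclicProd X f) (Y 0) (isUnit_det_cyclicProd hX f) (by
    have h := mul_cyclicProd hXY f
    have h0 : Fin.ofNat f f = 0 := by
      ext
      simp
    rw [h0] at h
    rw [h, Nat.cast_pow])
  obtain ⟨ρ, hρι, hρG⟩ := hW T ρ₁ (fun i => cyclicProd X i.val)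
    (fun i => isUnit_det_cyclicProd hX _)
  have hρΦ' : Φ.map ρ = cyclicProd X f := by
    rw [← hρΦ, ← hρι]
    rfl
  have hρN' : N.map ρ = Y 0 := by
    rw [← hρN, ← hρι]
    rfl
  have hinv : ∀ i, ((G i)⁻¹).map ρ = (cyclicProd X i.val)⁻¹ := fun i => by
    rw [← hρG i]
    exact Matrix.map_nonsing_inv_of_isUnit_det (ρ : W →+* T) (hG i)
  have hid : ρ.comp α = AlgHom.id k T := by
    refine hgen _ (fun i => ?_) (fun i => ?_)
    · have h1 : (X i).map (ρ.comp α) = ((X i).map α).map ρ := rfl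
      have h2 : (if i = 0 then Φ else 1).map ρ = if i = 0 then cyclicProd X f else 1 := by
        split_ifs
        · exact hρΦ'
        · exact Matrix.map_one _ (map_zero ρ) (map_one ρ)
      rw [h1, hαX, Matrix.map_mul, Matrix.map_mul, hρG, hinv, h2, cyclicProd_mul_inv hX]
    · have h1 : (Y i).map (ρ.comp α) = ((Y i).map α).map ρ := rfl
      have h2 : ∀ M : Matrix n n W, ((p : W) ^ i.val • M).map ρ = (p : T) ^ i.val • M.map ρ := by
        intro M
        ext a b
        simp
      have h3 := mul_cyclicProd hXY i.val
      rw [Fin.ofNat_val_eq_self] at h3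
      rw [h1, hαY, h2, Matrix.map_mul, Matrix.map_mul, hρG, hinv, hρN', ← smul_mul_assoc, ← h3,
        Matrix.mul_nonsing_inv_cancel_right _ _ (isUnit_det_cyclicProd hX _)]
  have hinj : Function.Injective α := by
    refine Function.LeftInverse.injective (g := ρ) fun t => ?_
    exact DFunLike.congr_fun hid t
  exact isReduced_of_injective α hinj

lemma isUnit_det_XmatL (i : Fin f) : IsUnit (XmatL k d f i).det := by
  have h : (XmatL k d f i).det = algebraMap (PKPoly k d f) (PKLoc k d f) (Xmat k d f i).det :=
    (RingHom.map_det _ _).symm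
  rw [h]
  refine isUnit_of_dvd_unit (map_dvd _ ?_) (IsLocalization.Away.algebraMap_isUnit (detProd k d f))
  exact Finset.dvd_prod_of_mem _ (Finset.mem_univ i)

/-- The algebra map from the polynomial ring sending the indeterminate matrices to given ones. -/
def evalMat {W : Type} [CommRing W] [Algebra k W] (X Y : Fin f → Matrix (Fin d) (Fin d) W) :
    PKPoly k d f →ₐ[k] W :=
  MvPolynomial.aeval fun t =>
    if t.1 = 0 then X t.2.1 t.2.2.1 t.2.2.2 else Y t.2.1 t.2.2.1 t.2.2.2

lemma map_evalMat_Xmat {W : Type} [CommRing W] [Algebra k W]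
    (X Y : Fin f → Matrix (Fin d) (Fin d) W) (i : Fin f) :
    (Xmat k d f i).map (evalMat k d f X Y) = X i := by
  ext a b
  simp [Xmat, evalMat]

lemma map_evalMat_Ymat {W : Type} [CommRing W] [Algebra k W]
    (X Y : Fin f → Matrix (Fin d) (Fin d) W) (i : Fin f) :
    (Ymat k d f i).map (evalMat k d f X Y) = Y i := by
  ext a b
  simp [Ymat, evalMat]

lemma exists_algHom_PKLoc {W : Type} [CommRing W] [Algebra k W]
    (X Y : Fin f → Matrix (Fin d) (Fin d) W) (hX : ∀ i, IsUnit (X i).det) :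
    ∃ α : PKLoc k d f →ₐ[k] W, (∀ i, (XmatL k d f i).map α = X i) ∧
      ∀ i, (YmatL k d f i).map α = Y i := by
  have hu : ∀ y : Submonoid.powers (detProd k d f), IsUnit (evalMat k d f X Y y) := by
    rintro ⟨_, e, rfl⟩
    change IsUnit (evalMat k d f X Y (detProd k d f ^ e))
    rw [map_pow, detProd, map_prod]
    refine IsUnit.pow e ?_
    refine Finset.prod_induction _ IsUnit (fun _ _ => IsUnit.mul) isUnit_one fun i _ => ?_
    rw [AlgHom.map_det, AlgHom.mapMatrix_apply, map_evalMat_Xmat]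
    exact hX i
  have hα : ∀ x, IsLocalization.liftAlgHom (S := PKLoc k d f)
      (M := Submonoid.powers (detProd k d f))
      hu (algebraMap (PKPoly k d f) (PKLoc k d f) x) = evalMat k d f X Y x := fun x => by
    rw [IsLocalization.liftAlgHom_apply, IsLocalization.lift_eq]
    rfl
  refine ⟨IsLocalization.liftAlgHom (M := Submonoid.powers (detProd k d f)) hu, fun i => ?_,
    fun i => ?_⟩
  · rw [← map_evalMat_Xmat k d f X Y i]
    ext a b
    exact hα _
  · rw [← map_evalMat_Ymat k d f X Y i]
    ext a b
    exact hα _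

lemma algHom_PKLoc_ext {W : Type} [CommRing W] [Algebra k W] {α β : PKLoc k d f →ₐ[k] W}
    (hX : ∀ i, (XmatL k d f i).map α = (XmatL k d f i).map β)
    (hY : ∀ i, (YmatL k d f i).map α = (YmatL k d f i).map β) : α = β := by
  refine IsLocalization.algHom_ext (Submonoid.powers (detProd k d f)) ?_
  refine MvPolynomial.algHom_ext fun ⟨s, i, a, b⟩ => ?_
  fin_cases s
  · exact congrFun (congrFun (hX i) a) b
  · exact congrFun (congrFun (hY i) a) b

/-- **Theorem 3.2 (ThmReduced), reducedness.** The coordinate ring `A/I` of the scheme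
`P_{K₀,d}` (base changed to a characteristic-zero field `k`) is reduced. -/
theorem statement0 [CharZero k] [NeZero f] (hp : p.Prime) (hd : 1 ≤ d) :
    IsReduced (PKLoc k d f ⧸ relIdeal k p d f) := by
  let π : PKLoc k d f →ₐ[k] PKLoc k d f ⧸ relIdeal k p d f := Ideal.Quotient.mkₐ k _
  refine isReduced_of_universal_cyclic (k := k) hp.two_le (fun i => (XmatL k d f i).map π)
    (fun i => (YmatL k d f i).map π) (fun i => ?_) (fun i => ?_) (fun α hαX hαY => ?_) ?_
  · rw [← AlgHom.mapMatrix_apply, ← AlgHom.map_det]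
    exact (isUnit_det_XmatL k d f i).map π
  · rw [← sub_eq_zero]
    ext a b
    have h : π (((p : PKLoc k d f) • (XmatL k d f i * YmatL k d f (i - 1)) -
        YmatL k d f i * XmatL k d f i) a b) = 0 :=
      Ideal.Quotient.eq_zero_iff_mem.mpr (Ideal.subset_span ⟨i, a, b, rfl⟩)
    simpa [Matrix.mul_apply] using h
  · refine Ideal.Quotient.algHom_ext k (algHom_PKLoc_ext k d f (fun i => ?_) fun i => ?_)
    · exact hαX i
    · exact hαY i
  · intro W _ _ X' Y' hX' hrel
    obtain ⟨α, hαX, hαY⟩ := exists_algHom_PKLoc k d f X' Y' hX'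
    have hker : ∀ x ∈ relIdeal k p d f, α x = 0 := by
      have : relIdeal k p d f ≤ RingHom.ker α := by
        rw [relIdeal, Ideal.span_le]
        rintro _ ⟨i, a, b, rfl⟩
        have h := hrel i
        rw [← hαX, ← hαY, ← hαY] at h
        have h' := congrFun (congrFun h a) b
        rw [← sub_eq_zero] at h'
        simpa [Matrix.mul_apply] using h'
      exact this
    exact ⟨Ideal.Quotient.liftₐ _ α hker, fun i => hαX i, fun i => hαY i⟩
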